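/- arXiv:1606.04338 — 3 statements merged into one kernel-verified Lean document; each statement's English description precedes it below -/
import Mathlib

section
/- For every nonzero matrix A ∈ ℤ^{ℓ×k} of rank ℓ, there exists a nonsingular matrix V ∈ ℤ^{ℓ×ℓ} and a matrix H ∈ ℤ^{ℓ×k} in Hermite normal form whose row lattice is saturated in ℤ^k, such that A = V H. -/
noncomputable section

/-- `H ∈ ℤ^{ℓ×k}` is in (row-echelon) Hermite Normal Form: there are strictly
increasing pivot columns `p i`, the pivot entries are positive, entries to the left
of a pivot are zero, and entries above a pivot are nonnegative and smaller than
the pivot. -/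
def IsHNF {l k : ℕ} (H : Matrix (Fin l) (Fin k) ℤ) : Prop :=
  ∃ p : Fin l → Fin k, StrictMono p ∧
    (∀ i, 0 < H i (p i)) ∧
    (∀ (i : Fin l) (j : Fin k), (j : ℕ) < (p i : ℕ) → H i j = 0) ∧
    (∀ i i', i' < i → 0 ≤ H i' (p i) ∧ H i' (p i) < H i (p i))

/-- The lattice spanned by the rows of `H` is saturated in `ℤ^k`: any integer
vector in the real span of the rows lies in the integer row lattice. -/
def IsSaturated {l k : ℕ} (H : Matrix (Fin l) (Fin k) ℤ) : Prop :=
  ∀ v : Fin k → ℤ,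
    (fun j => (v j : ℝ)) ∈ Submodule.span ℝ (Set.range fun i j => ((H i j : ℤ) : ℝ)) →
    v ∈ Submodule.span ℤ (Set.range fun i => H i)

/-- Full rank integer matrices have linearly independent rows. -/
theorem rows_indep_of_rank {l k : ℕ} (A : Matrix (Fin l) (Fin k) ℤ) (hrank : A.rank = l) :
    LinearIndependent ℤ (fun i => A i) := by
  rw [Fintype.linearIndependent_iff]
  intro w hw
  let φ : (Fin l → ℤ) →ₗ[ℤ] ℤ := ∑ i, w i • LinearMap.proj i
  have hφ : ∀ x, φ x = ∑ i, w i * x i := by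
    intro x
    simp [φ, LinearMap.sum_apply]
  have hle : LinearMap.range A.mulVecLin ≤ LinearMap.ker φ := by
    rintro _ ⟨x, rfl⟩
    rw [LinearMap.mem_ker, hφ]
    simp only [Matrix.mulVecLin_apply, Matrix.mulVec, dotProduct, Finset.mul_sum]
    rw [Finset.sum_comm]
    apply Finset.sum_eq_zero
    intro j _
    have h := congrFun hw j
    simp only [Finset.sum_apply, Pi.smul_apply, smul_eq_mul, Pi.zero_apply] at h
    have : ∑ i, w i * (A i j * x j) = (∑ i, w i * A i j) * x j := by
      rw [Finset.sum_mul]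
      exact Finset.sum_congr rfl fun i _ => by ring
    rw [this, h, zero_mul]
  have h1 := Submodule.finrank_mono hle
  have h2 := Submodule.finrank_quotient_add_finrank (LinearMap.ker φ)
  rw [φ.quotKerEquivRange.finrank_eq] at h2
  have h3 : Module.finrank ℤ (LinearMap.range A.mulVecLin) = l := hrank
  rw [Module.finrank_fintype_fun_eq_card, Fintype.card_fin] at h2
  have h4 : Module.finrank ℤ (LinearMap.range φ) = 0 := by omega
  rw [Submodule.finrank_eq_zero, LinearMap.range_eq_bot] at h4
  intro i
  have h5 := hφ (Pi.single i 1)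
  rw [h4] at h5
  simpa [Pi.single_apply] using h5.symm

/-- Rows of a matrix in Hermite normal form are linearly independent. -/
theorem IsHNF.rows_indep {l k : ℕ} {H : Matrix (Fin l) (Fin k) ℤ} (hH : IsHNF H) :
    LinearIndependent ℤ (fun i => H i) := by
  obtain ⟨p, hp, hpos, hz, -⟩ := hH
  rw [Fintype.linearIndependent_iff]
  intro w hw i
  induction i using WellFoundedLT.induction with
  | _ i ih =>
    have h := congrFun hw (p i)
    simp only [Finset.sum_apply, Pi.smul_apply, smul_eq_mul, Pi.zero_apply] at h
    rw [Finset.sum_eq_single i] at h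
    · exact (mul_eq_zero.mp h).resolve_right (hpos i).ne'
    · intro j _ hj
      rcases lt_or_gt_of_ne hj with h' | h'
      · rw [ih j h', zero_mul]
      · rw [hz j (p i) (hp h'), mul_zero]
    · simp

theorem exists_reduction {l k : ℕ} {H : Matrix (Fin l) (Fin k) ℤ} {p : Fin l → Fin k}
    (hp : StrictMono p) (hpos : ∀ i, 0 < H i (p i))
    (hz : ∀ (i : Fin l) (j : Fin k), (j : ℕ) < (p i : ℕ) → H i j = 0)
    (u : Fin k → ℤ) (m : ℕ) (hm : m ≤ l) :
    ∃ w ∈ Submodule.span ℤ (Set.range fun i => H i),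
      ∀ i : Fin l, (i : ℕ) < m → 0 ≤ (u - w) (p i) ∧ (u - w) (p i) < H i (p i) := by
  induction m with
  | zero => exact ⟨0, Submodule.zero_mem _, fun i hi => absurd hi (Nat.not_lt_zero _)⟩
  | succ m ih =>
    obtain ⟨w, hw, hr⟩ := ih (by omega)
    let a : Fin l := ⟨m, by omega⟩
    let q := (u - w) (p a) / H a (p a)
    refine ⟨w + q • H a, Submodule.add_mem _ hw (Submodule.smul_mem _ _
      (Submodule.subset_span ⟨a, rfl⟩)), fun i hi => ?_⟩
    have hval : (u - (w + q • H a)) (p i) = (u - w) (p i) - q * H a (p i) := by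
      simp only [Pi.sub_apply, Pi.add_apply, Pi.smul_apply, smul_eq_mul]; ring
    rw [hval]
    rcases Nat.lt_succ_iff_lt_or_eq.mp hi with h | h
    · have : i < a := h
      rw [hz a (p i) (hp this), mul_zero, sub_zero]
      exact hr i h
    · have : i = a := Fin.ext h
      subst this
      have e : (u - w) (p a) - q * H a (p a) = (u - w) (p a) % H a (p a) := by
        rw [Int.emod_def]; simp only [q]; ring
      rw [e]
      exact ⟨Int.emod_nonneg _ (hpos a).ne', Int.emod_lt_of_pos _ (hpos a)⟩

/-- Prepending a zero coordinate. -/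
def consZero (k : ℕ) : (Fin k → ℤ) →ₗ[ℤ] (Fin (k + 1) → ℤ) where
  toFun v := Fin.cons (α := fun _ => ℤ) 0 v
  map_add' v w := by
    ext j; refine Fin.cases ?_ (fun j => ?_) j <;> simp
  map_smul' c v := by
    ext j; refine Fin.cases ?_ (fun j => ?_) j <;> simp

theorem consZero_zero {k : ℕ} (v : Fin k → ℤ) : consZero k v 0 = 0 := rfl

theorem consZero_succ {k : ℕ} (v : Fin k → ℤ) (j : Fin k) : consZero k v j.succ = v j := rfl

theorem consZero_tail {k : ℕ} (v : Fin (k + 1) → ℤ) (h : v 0 = 0) :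
    consZero k (fun j => v j.succ) = v := by
  ext j
  refine Fin.cases ?_ (fun j => ?_) j
  · rw [consZero_zero, h]
  · rw [consZero_succ]

/-- Every submodule of `ℤ^k` has a basis in Hermite normal form. -/
theorem exists_HNF_basis (k : ℕ) (M : Submodule ℤ (Fin k → ℤ)) :
    ∃ (n : ℕ) (H : Matrix (Fin n) (Fin k) ℤ), IsHNF H ∧
      Submodule.span ℤ (Set.range fun i => H i) = M := by
  induction k with
  | zero =>
    refine ⟨0, 0, ⟨Fin.elim0, fun i => i.elim0, fun i => i.elim0, fun i => i.elim0,
      fun i => i.elim0⟩, ?_⟩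
    exact Subsingleton.elim _ _
  | succ k ih =>
    obtain ⟨n, H, ⟨p, hp, hpos, hz, hred⟩, hspan⟩ := ih (M.comap (consZero k))
    have hmem : ∀ v ∈ M, v 0 = 0 →
        v ∈ (Submodule.span ℤ (Set.range fun i => H i)).map (consZero k) := by
      intro v hv h0
      refine ⟨fun j => v j.succ, ?_, consZero_tail v h0⟩
      rw [hspan]
      change consZero k _ ∈ M
      rwa [consZero_tail v h0]
    have hmem' : ∀ i, consZero k (H i) ∈ M := by
      intro i
      have : H i ∈ M.comap (consZero k) := hspan ▸ Submodule.subset_span ⟨i, rfl⟩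
      exact this
    have hrange : (Submodule.span ℤ (Set.range fun i => H i)).map (consZero k) =
        Submodule.span ℤ (Set.range fun i => consZero k (H i)) := by
      rw [Submodule.map_span, ← Set.range_comp]; rfl
    by_cases hM : ∀ v ∈ M, v 0 = 0
    · refine ⟨n, fun i => consZero k (H i), ⟨fun i => (p i).succ, ?_, ?_, ?_, ?_⟩, ?_⟩
      · exact fun i j h => Fin.succ_lt_succ_iff.mpr (hp h)
      · exact hpos
      · intro i j
        refine Fin.cases ?_ (fun j => ?_) j
        · intro _; rfl
        · intro h
          exact hz i j (by simpa using h)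
      · exact hred
      · apply le_antisymm
        · rw [Submodule.span_le]
          rintro _ ⟨i, rfl⟩
          exact hmem' i
        · intro v hv
          rw [← hrange]
          exact hmem v hv (hM v hv)
    · push Not at hM
      obtain ⟨v₀, hv₀, hv₀0⟩ := hM
      obtain ⟨d, hd⟩ := (IsPrincipalIdealRing.principal
        (M.map (LinearMap.proj (R := ℤ) (φ := fun _ : Fin (k + 1) => ℤ) 0))).principal
      have hdvd : ∀ v ∈ M, d ∣ v 0 := by
        intro v hv
        have : v 0 ∈ (M.map (LinearMap.proj (R := ℤ) (φ := fun _ : Fin (k + 1) => ℤ) 0)) :=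
          ⟨v, hv, rfl⟩
        rw [hd, Submodule.mem_span_singleton] at this
        obtain ⟨c, hc⟩ := this
        exact ⟨c, by rw [← hc, smul_eq_mul, mul_comm]⟩
      have hd0 : d ≠ 0 := by
        rintro rfl
        exact hv₀0 (zero_dvd_iff.mp (hdvd v₀ hv₀))
      have hu : ∃ u ∈ M, u 0 = |d| := by
        have : d ∈ (M.map (LinearMap.proj (R := ℤ) (φ := fun _ : Fin (k + 1) => ℤ) 0)) := by
          rw [hd]; exact Submodule.mem_span_singleton_self d
        obtain ⟨u, hu, hud⟩ := this
        have hud' : u 0 = d := hud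
        rcases abs_choice d with h | h
        · exact ⟨u, hu, by rw [h, hud']⟩
        · exact ⟨-u, M.neg_mem hu, by rw [h, Pi.neg_apply, hud']⟩
      obtain ⟨u, hu, hud⟩ := hu
      obtain ⟨w, hw, hwr⟩ := exists_reduction hp hpos hz (fun j => u j.succ) n le_rfl
      have hwM : consZero k w ∈ M := by
        have : w ∈ M.comap (consZero k) := hspan ▸ hw
        exact this
      let u' : Fin (k + 1) → ℤ := u - consZero k w
      have hu' : u' ∈ M := M.sub_mem hu hwM
      have hu'0 : u' 0 = |d| := by
        simp only [u', Pi.sub_apply, consZero_zero, sub_zero, hud]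
      let H' : Matrix (Fin (n + 1)) (Fin (k + 1)) ℤ :=
        Fin.cons (α := fun _ => Fin (k + 1) → ℤ) u' (fun i => consZero k (H i))
      let p' : Fin (n + 1) → Fin (k + 1) :=
        Fin.cons (α := fun _ => Fin (k + 1)) 0 (fun i => (p i).succ)
      refine ⟨n + 1, H', ⟨p', ?_, ?_, ?_, ?_⟩, ?_⟩
      · intro i j
        refine Fin.cases ?_ (fun i => ?_) i <;> refine Fin.cases ?_ (fun j => ?_) j
        · intro h; exact absurd h (lt_irrefl _)
        · intro _; exact Fin.succ_pos _
        · intro h; exact absurd h (Fin.not_lt_zero _)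
        · intro h; exact Fin.succ_lt_succ_iff.mpr (hp (Fin.succ_lt_succ_iff.mp h))
      · intro i
        refine Fin.cases ?_ (fun i => ?_) i
        · change 0 < u' 0
          rw [hu'0]; exact abs_pos.mpr hd0
        · exact hpos i
      · intro i j
        refine Fin.cases ?_ (fun i => ?_) i
        · intro h; exact absurd h (Nat.not_lt_zero _)
        · refine Fin.cases ?_ (fun j => ?_) j
          · intro _; rfl
          · intro h
            exact hz i j (Nat.lt_of_succ_lt_succ h)
      · intro i i'
        refine Fin.cases ?_ (fun i => ?_) i
        · intro h; exact absurd h (Fin.not_lt_zero _)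
        · refine Fin.cases ?_ (fun i' => ?_) i'
          · intro _; exact hwr i i.2
          · intro h; exact hred i i' (Fin.succ_lt_succ_iff.mp h)
      · apply le_antisymm
        · rw [Submodule.span_le]
          rintro _ ⟨i, rfl⟩
          refine Fin.cases ?_ (fun i => ?_) i
          · exact hu'
          · exact hmem' i
        · intro v hv
          obtain ⟨c, hc⟩ := (abs_dvd d (v 0)).mpr (hdvd v hv)
          have h1 : v - c • u' ∈ M := M.sub_mem hv (M.smul_mem c hu')
          have h2 : (v - c • u') 0 = 0 := by
            rw [Pi.sub_apply, Pi.smul_apply, hu'0, hc, smul_eq_mul]; ring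
          have h3 := hmem _ h1 h2
          rw [hrange] at h3
          have h4 : Submodule.span ℤ (Set.range fun i => consZero k (H i)) ≤
              Submodule.span ℤ (Set.range fun i => H' i) := by
            apply Submodule.span_mono
            rintro _ ⟨i, rfl⟩
            exact ⟨i.succ, rfl⟩
          have h5 : u' ∈ Submodule.span ℤ (Set.range fun i => H' i) :=
            Submodule.subset_span ⟨0, rfl⟩
          have := Submodule.add_mem _ (h4 h3) (Submodule.smul_mem _ c h5)
          simpa using this

/-- The coordinatewise cast as an additive-linear map. -/
def castLin (k : ℕ) : (Fin k → ℤ) →ₗ[ℤ] (Fin k → ℝ) where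
  toFun v j := (v j : ℝ)
  map_add' v w := by ext j; simp
  map_smul' c v := by ext j; simp

theorem real_indep {l k : ℕ} {A : Matrix (Fin l) (Fin k) ℤ}
    (h : LinearIndependent ℤ (fun i => A i)) :
    LinearIndependent ℝ (fun i j => ((A i j : ℤ) : ℝ)) :=
  (linearIndependent_algebraMap_comp_iff (R := ℤ) (S := ℝ) (v := fun i => A i)).mpr h

theorem cast_mem_span {n k : ℕ} {H : Matrix (Fin n) (Fin k) ℤ} {v : Fin k → ℤ}
    (hv : v ∈ Submodule.span ℤ (Set.range fun i => H i)) :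
    castLin k v ∈ Submodule.span ℝ (Set.range fun i j => ((H i j : ℤ) : ℝ)) := by
  have : Submodule.span ℤ (Set.range fun i => H i) ≤
      ((Submodule.span ℝ (Set.range fun i j => ((H i j : ℤ) : ℝ))).restrictScalars ℤ).comap
        (castLin k) := by
    rw [Submodule.span_le]
    rintro _ ⟨i, rfl⟩
    exact Submodule.subset_span ⟨i, rfl⟩
  exact this hv

/-- Every nonzero integer matrix `A ∈ ℤ^{ℓ×k}` of rank `ℓ` factors as `A = V H`
with `V ∈ ℤ^{ℓ×ℓ}` nonsingular and `H` in Saturated Hermite Normal Form. -/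
theorem exists_SHNF_factorization {l k : ℕ} (A : Matrix (Fin l) (Fin k) ℤ)
    (hA : A ≠ 0) (hrank : A.rank = l) :
    ∃ (V : Matrix (Fin l) (Fin l) ℤ) (H : Matrix (Fin l) (Fin k) ℤ),
      V.det ≠ 0 ∧ IsHNF H ∧ IsSaturated H ∧ A = V * H := by
  have hAi := rows_indep_of_rank A hrank
  let S := Submodule.span ℝ (Set.range fun i j => ((A i j : ℤ) : ℝ))
  obtain ⟨n, H, hH, hspan⟩ := exists_HNF_basis k ((S.restrictScalars ℤ).comap (castLin k))
  have hAH : ∀ i, A i ∈ Submodule.span ℤ (Set.range fun i => H i) := by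
    intro i
    rw [hspan]
    exact Submodule.subset_span (s := Set.range fun i j => ((A i j : ℤ) : ℝ)) ⟨i, rfl⟩
  have hSH : Submodule.span ℝ (Set.range fun i j => ((H i j : ℤ) : ℝ)) = S := by
    apply le_antisymm
    · rw [Submodule.span_le]
      rintro _ ⟨i, rfl⟩
      have : H i ∈ (S.restrictScalars ℤ).comap (castLin k) :=
        hspan ▸ Submodule.subset_span ⟨i, rfl⟩
      exact this
    · rw [Submodule.span_le]
      rintro _ ⟨i, rfl⟩
      exact cast_mem_span (hAH i)
  have hn : n = l := by
    have h1 := finrank_span_eq_card (real_indep hAi)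
    have h2 := finrank_span_eq_card (real_indep hH.rows_indep)
    rw [hSH] at h2
    rw [Fintype.card_fin] at h1 h2
    exact h2.symm.trans h1
  subst hn
  have hc : ∀ i, ∃ c : Fin n → ℤ, ∑ a, c a • H a = A i := fun i =>
    (Submodule.mem_span_range_iff_exists_fun ℤ).mp (hAH i)
  choose V hV using hc
  have hfac : A = Matrix.of V * H := by
    ext i j
    rw [← hV i, Matrix.mul_apply]
    simp
  refine ⟨Matrix.of V, H, ?_, hH, ?_, hfac⟩
  · intro hdet
    obtain ⟨w, hw, hwV⟩ := Matrix.exists_vecMul_eq_zero_iff.mpr hdet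
    apply hw
    have hwA : Matrix.vecMul w A = 0 := by
      rw [hfac, ← Matrix.vecMul_vecMul, hwV, Matrix.zero_vecMul]
    ext i
    refine Fintype.linearIndependent_iff.mp hAi w ?_ i
    rw [← hwA]
    ext j
    simp [Matrix.vecMul, dotProduct]
  · intro v hv
    rw [hSH] at hv
    rw [hspan]
    exact hv
end
end

section
/- Let F be a nonzero Laurent polynomial in k variables with complex coefficients. Then for every A ∈ ℤ^{ℓ×k} with F_A ≠ 0, the value m(F_A) is a limit of values m(F_r) with r ∈ ℤ^k (one-row substitutions); consequently ℳ(F) is contained in the closure of ℳ₁(F) := { m(F_r) : r ∈ ℤ^k, F_r ≠ 0 }. -/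
open MeasureTheory

noncomputable section

/-- A Laurent polynomial in `k` variables, given by its finitely supported
coefficient function on exponent vectors in `ℤ^k`. -/
abbrev LPoly (k : ℕ) := (Fin k → ℤ) →₀ ℂ

/-- Evaluation of a Laurent polynomial at a point of `ℂ^k`. -/
def evalT {k : ℕ} (F : LPoly k) (z : Fin k → ℂ) : ℂ :=
  ∑ e ∈ F.support, F e * ∏ i, z i ^ (e i)

/-- The point of the `k`-torus with angles `t`. -/
def torusPt {k : ℕ} (t : Fin k → ℝ) : Fin k → ℂ :=
  fun i => Complex.exp (2 * Real.pi * Complex.I * (t i))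

/-- The logarithmic Mahler measure of a Laurent polynomial in `k` variables. -/
def mm {k : ℕ} (F : LPoly k) : ℝ :=
  ∫ t in Set.Icc (0 : Fin k → ℝ) 1, Real.log ‖evalT F (torusPt t)‖

/-- The exponent substitution attached to an integer matrix `A ∈ ℤ^{ℓ×k}`. -/
def substExp {l k : ℕ} (A : Matrix (Fin l) (Fin k) ℤ) (e : Fin k → ℤ) : Fin l → ℤ :=
  fun i => ∑ j, A i j * e j

/-- `substM A F` is the Laurent polynomial `F_A(z) = F(z^A)` in `ℓ` variables. -/
def substM {l k : ℕ} (A : Matrix (Fin l) (Fin k) ℤ) (F : LPoly k) : LPoly l :=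
  Finsupp.mapDomain (substExp A) F

/-- A one-row integer matrix from a vector `r ∈ ℤ^k`. -/
def rowMat {k : ℕ} (r : Fin k → ℤ) : Matrix (Fin 1) (Fin k) ℤ :=
  Matrix.of fun _ j => r j

/-- The set `ℳ(F)` of Mahler measures of all the nonzero `F_A`. -/
def Mset {k : ℕ} (F : LPoly k) : Set ℝ :=
  { x | ∃ (l : ℕ) (A : Matrix (Fin l) (Fin k) ℤ), substM A F ≠ 0 ∧ mm (substM A F) = x }

/-- The set `ℳ₁(F)` of Mahler measures of the nonzero one-variable substitutions `F_r`. -/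
def M1set {k : ℕ} (F : LPoly k) : Set ℝ :=
  { x | ∃ r : Fin k → ℤ, substM (rowMat r) F ≠ 0 ∧ mm (substM (rowMat r) F) = x }




namespace MahlerAux
open Polynomial Filter Topology

/-- `e(t) = exp(2πit)`. -/
def ee (t : ℝ) : ℂ := Complex.exp (2 * Real.pi * Complex.I * t)

/-- Lebesgue measure on the unit interval. -/
def nu : Measure ℝ := volume.restrict (Set.Icc 0 1)

instance : IsProbabilityMeasure nu := by
  constructor
  simp [nu]

lemma ee_add (a b : ℝ) : ee (a + b) = ee a * ee b := by
  simp only [ee, ← Complex.exp_add]; congr 1; push_cast; ring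

lemma ee_one : ee 1 = 1 := by
  simp [ee, Complex.exp_two_pi_mul_I]

lemma ee_zero : ee 0 = 1 := by
  simp [ee]

lemma ee_nat_mul (n : ℕ) (t : ℝ) : ee (n * t) = ee t ^ n := by
  simp only [ee, ← Complex.exp_nat_mul]; congr 1; push_cast; ring

lemma ee_int_mul (n : ℤ) (t : ℝ) : ee (n * t) = ee t ^ n := by
  simp only [ee, ← Complex.exp_int_mul]; congr 1; push_cast; ring

lemma norm_ee (t : ℝ) : ‖ee t‖ = 1 := by
  have : (2 * Real.pi * Complex.I * t : ℂ) = ((2 * Real.pi * t : ℝ) : ℂ) * Complex.I := by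
    push_cast; ring
  rw [ee, this, Complex.norm_exp_ofReal_mul_I]

lemma continuous_ee : Continuous ee := by
  unfold ee; fun_prop

lemma ee_ne_zero (t : ℝ) : ee t ≠ 0 := Complex.exp_ne_zero _

lemma ee_eq_circleMap (t : ℝ) : ee t = circleMap 0 1 (2 * Real.pi * t) := by
  simp only [ee, circleMap]; push_cast; simp; congr 1; ring

lemma exists_ee {ζ : ℂ} (h : ‖ζ‖ = 1) : ∃ a, ζ = ee a := by
  refine ⟨ζ.arg / (2 * Real.pi), ?_⟩
  have h1 := Complex.norm_mul_exp_arg_mul_I ζ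
  rw [h, Complex.ofReal_one, one_mul] at h1
  have h2 : (Real.pi : ℂ) ≠ 0 := by exact_mod_cast Real.pi_ne_zero
  rw [ee]
  conv_lhs => rw [← h1]
  congr 1
  push_cast
  field_simp

lemma integral_nu (f : ℝ → ℝ) : ∫ s, f s ∂nu = ∫ s in (0:ℝ)..1, f s := by
  rw [nu, intervalIntegral.integral_of_le zero_le_one, integral_Icc_eq_integral_Ioc]

lemma integrable_nu (f : ℝ → ℝ) : Integrable f nu ↔ IntervalIntegrable f volume 0 1 := by
  rw [nu, intervalIntegrable_iff_integrableOn_Icc_of_le zero_le_one, IntegrableOn]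

lemma mahler_eq (q : ℂ[X]) : q.logMahlerMeasure = ∫ s, Real.log ‖q.eval (ee s)‖ ∂nu := by
  rw [integral_nu, logMahlerMeasure_def, Real.circleAverage_def]
  simp only [ee_eq_circleMap]
  rw [intervalIntegral.integral_comp_mul_left 
    (fun x => Real.log ‖q.eval (circleMap 0 1 x)‖) (by positivity)]
  simp

lemma mahler_integrable (q : ℂ[X]) : Integrable (fun s => Real.log ‖q.eval (ee s)‖) nu := by
  rw [integrable_nu]
  simp only [ee_eq_circleMap]
  have := q.intervalIntegrable_mahlerMeasure.comp_mul_left (c := 2 * Real.pi)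
  simpa using this

lemma ae_nu_of_finite {S : Set ℂ} (hS : S.Finite) : ∀ᵐ s ∂nu, ee s ∉ S := by
  have h1 : ∀ z : ℂ, ∀ᵐ s ∂nu, ee s ≠ z := by
    intro z
    by_cases hz : ∃ a, ee a = z
    · obtain ⟨a, rfl⟩ := hz
      have : {s | ee s = ee a}.Countable := by
        have : {s | ee s = ee a} ⊆ Set.range (fun n : ℤ => a + n) := by
          intro s hs
          simp only [Set.mem_ofPred_eq, ee, Complex.exp_eq_exp_iff_exists_int] at hs
          obtain ⟨n, hn⟩ := hs
          refine ⟨n, ?_⟩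
          have h2 : (2 * Real.pi * Complex.I : ℂ) ≠ 0 := Complex.two_pi_I_ne_zero
          have : (s : ℂ) = a + n := by
            apply mul_left_cancel₀ h2; rw [hn]; ring
          simp only
          exact_mod_cast this.symm
        exact (Set.countable_range _).mono this
      have h0 : nu {s | ee s = ee a} = 0 := by
        have := this.measure_zero volume
        exact Measure.absolutelyContinuous_of_le Measure.restrict_le_self this
      simpa [ae_iff] using h0
    · exact Eventually.of_forall fun s hs => hz ⟨s, hs⟩
  have := (ae_ball_iff hS.countable).2 (fun z (_ : z ∈ S) => h1 z)
  filter_upwards [this] with s hs hmem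
  exact hs _ hmem rfl

lemma ae_eval_ne {q : ℂ[X]} (hq : q ≠ 0) : ∀ᵐ s ∂nu, q.eval (ee s) ≠ 0 := by
  have := ae_nu_of_finite (S := {z | q.IsRoot z}) (finite_setOfPred_isRoot hq)
  filter_upwards [this] with s hs using hs

lemma periodic_shift (f : ℝ → ℝ) (hf : Function.Periodic f 1) (a : ℝ) :
    ∫ s, f (s + a) ∂nu = ∫ s, f s ∂nu := by
  rw [integral_nu, integral_nu, intervalIntegral.integral_comp_add_right]
  have := hf.intervalIntegral_add_eq a 0
  simpa [add_comm] using this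

lemma periodic_ee (g : ℂ → ℝ) : Function.Periodic (fun s => g (ee s)) 1 := by
  intro s; simp [ee_add, ee_one]

lemma eval_comp_scale (q : ℂ[X]) (a z : ℂ) : (q.comp (C a * X)).eval z = q.eval (a * z) := by
  simp

lemma mahler_rot (q : ℂ[X]) {ζ : ℂ} (h : ‖ζ‖ = 1) :
    (q.comp (C ζ * X)).logMahlerMeasure = q.logMahlerMeasure := by
  obtain ⟨a, rfl⟩ := exists_ee h
  rw [mahler_eq, mahler_eq, 
    ← periodic_shift (fun s => Real.log ‖q.eval (ee s)‖) (periodic_ee (fun z => Real.log ‖q.eval z‖)) a]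
  congr 1
  ext s
  rw [eval_comp_scale, ee_add, mul_comm]

lemma mahler_expand (q : ℂ[X]) {n : ℕ} (hn : n ≠ 0) :
    (expand ℂ n q).logMahlerMeasure = q.logMahlerMeasure := by
  rw [mahler_eq, mahler_eq, integral_nu, integral_nu]
  simp only [expand_eval, ← ee_nat_mul]
  have hn' : (n : ℝ) ≠ 0 := by exact_mod_cast hn
  rw [intervalIntegral.integral_comp_mul_left (fun s => Real.log ‖q.eval (ee s)‖) hn']
  have := (periodic_ee (fun z => Real.log ‖q.eval z‖)).intervalIntegral_add_zsmul_eq n 0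
    (fun t₁ t₂ => by
      have hi := (integrable_nu _).1 (mahler_integrable q)
      exact (periodic_ee (fun z => Real.log ‖q.eval z‖)).intervalIntegrable₀ zero_ne_one.symm hi t₁ t₂)
  simp at this
  simp [hn', this]

/-- Comparison of Mahler measures on circles of different radii. -/
lemma mahler_scale_aux (a : ℂ) (m : Multiset ℂ) {R : ℝ} (hR : 1 ≤ R) :
    let Q := C a * (m.map (fun b => X - C b)).prod
    Q.mahlerMeasure ≤ (Q.comp (C (R : ℂ) * X)).mahlerMeasure ∧
    (Q.comp (C (R : ℂ) * X)).mahlerMeasure ≤ Q.mahlerMeasure * R ^ Multiset.card m := by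
  induction m using Multiset.induction with
  | empty => simp
  | cons b m ih =>
    simp only [Multiset.map_cons, Multiset.prod_cons] at ih ⊢
    set Q := C a * (m.map (fun b => X - C b)).prod with hQ
    have h1 : C a * ((X - C b) * (m.map (fun b => X - C b)).prod) = (X - C b) * Q := by
      rw [hQ]; ring
    rw [h1, mul_comp, mahlerMeasure_mul _ Q, mahlerMeasure_mul _ (Q.comp _), mahlerMeasure_X_sub_C]
    have h2 : ((X - C b).comp (C (R : ℂ) * X)).mahlerMeasure = max R ‖b‖ := by
      have hR0 : (R : ℂ) ≠ 0 := by
        have : R ≠ 0 := by positivity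
        exact_mod_cast this
      have : (X - C b).comp (C (R : ℂ) * X) = C (R : ℂ) * X + C (-b) := by
        simp [sub_eq_add_neg]
      rw [this, mahlerMeasure_C_mul_X_add_C hR0]
      have hR1 : 0 < R := by positivity
      simp [abs_of_pos hR1]
    rw [h2]
    have hM := mahlerMeasure_nonneg Q
    have hM' := mahlerMeasure_nonneg (Q.comp (C (R : ℂ) * X))
    constructor
    · exact mul_le_mul (max_le_max hR le_rfl) ih.1 hM (by positivity)
    · rw [Multiset.card_cons]
      calc _ ≤ (max 1 ‖b‖ * R) * (Q.mahlerMeasure * R ^ Multiset.card m) := by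
            apply mul_le_mul _ ih.2 hM' (by positivity)
            rcases le_total R ‖b‖ with h | h
            · rw [max_eq_right h]; nlinarith [le_max_right 1 ‖b‖, le_max_left 1 ‖b‖]
            · rw [max_eq_left h]; nlinarith [le_max_right 1 ‖b‖, le_max_left 1 ‖b‖]
        _ = _ := by ring

lemma comp_scale_ne {q : ℂ[X]} (hq : q ≠ 0) {R : ℝ} (hR : 1 ≤ R) : 
    q.comp (C (R : ℂ) * X) ≠ 0 := by
  have hR0 : (R : ℂ) ≠ 0 := by
    have : R ≠ 0 := by positivity
    exact_mod_cast this
  intro h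
  apply hq
  have : (q.comp (C (R : ℂ) * X)).comp (C (R : ℂ)⁻¹ * X) = q := by
    rw [comp_assoc]; simp [← mul_assoc, ← C_mul, hR0]
  rw [← this, h]; simp

lemma natDegree_comp_scale (q : ℂ[X]) (R : ℂ) : 
    (q.comp (C R * X)).natDegree ≤ q.natDegree := by
  refine natDegree_comp_le.trans ?_
  have : (C R * X : ℂ[X]).natDegree ≤ 1 := by simpa using natDegree_C_mul_X_pow_le R 1
  nlinarith

lemma mahler_scale (Q : ℂ[X]) {R : ℝ} (hR : 1 ≤ R) :
    Q.logMahlerMeasure ≤ (Q.comp (C (R : ℂ) * X)).logMahlerMeasure ∧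
    (Q.comp (C (R : ℂ) * X)).logMahlerMeasure ≤ Q.logMahlerMeasure + Q.natDegree * Real.log R := by
  by_cases hQ : Q = 0
  · simp [hQ]
  have := mahler_scale_aux Q.leadingCoeff Q.roots hR
  have hs := (IsAlgClosed.splits Q).eq_prod_roots
  simp only [← hs] at this
  have hc : Multiset.card Q.roots = Q.natDegree := (IsAlgClosed.splits Q).natDegree_eq_card_roots.symm
  rw [hc] at this
  simp only [logMahlerMeasure_eq_log_MahlerMeasure]
  have h1 := mahlerMeasure_pos_of_ne_zero hQ
  have h2 := mahlerMeasure_pos_of_ne_zero (comp_scale_ne hQ hR)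
  refine ⟨Real.log_le_log h1 this.1, ?_⟩
  refine (Real.log_le_log h2 this.2).trans ?_
  rw [Real.log_mul h1.ne' (by positivity), Real.log_pow]


/-- Tail function controlling uniform integrability. -/
def eta (K : ℝ) : ℝ := ∫ s, max (-Real.log (Real.sin (2 * Real.pi * s)) - K) 0 ∂nu

/-- Normalised logarithm of a linear factor. -/
def tl (α : ℂ) (s : ℝ) : ℝ := Real.log ‖ee s - α‖ - Real.posLog ‖α‖

lemma integrable_log_sin (a : ℝ) :
    Integrable (fun s => Real.log (Real.sin (2 * Real.pi * (s - a)))) nu := by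
  rw [integrable_nu]
  have h := (intervalIntegrable_log_sin (a := 2 * Real.pi * (0 - a)) (b := 2 * Real.pi * (1 - a)))
  have := (h.comp_mul_left (c := 2 * Real.pi)).comp_sub_right a
  have hp : (2 * Real.pi) ≠ 0 := by positivity
  have e : -(2 * Real.pi * a) / (2 * Real.pi) + a = 0 := by field_simp; ring
  simpa [hp, e] using this

lemma eta_shift (K a : ℝ) :
    ∫ s, max (-Real.log (Real.sin (2 * Real.pi * (s - a))) - K) 0 ∂nu = eta K := by
  have := periodic_shift (fun s => max (-Real.log (Real.sin (2 * Real.pi * s)) - K) 0)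
    (by intro s; simp [mul_add, Real.sin_add_two_pi]) (-a)
  simpa [eta, sub_eq_add_neg] using this

lemma eta_tendsto : Tendsto (fun K : ℕ => eta K) atTop (𝓝 0) := by
  have h0 : (0 : ℝ) = ∫ s, (fun _ => (0:ℝ)) s ∂nu := by simp
  rw [h0]
  have hi := integrable_log_sin 0
  simp only [sub_zero] at hi
  unfold eta
  apply tendsto_integral_of_dominated_convergence 
    (fun s => |Real.log (Real.sin (2 * Real.pi * s))|)
  · intro K
    have h1 := (hi.neg.sub (integrable_const (K : ℝ))).sup (integrable_const (0:ℝ))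
    exact h1.aestronglyMeasurable
  · exact hi.abs
  · intro K
    refine Eventually.of_forall fun s => ?_
    rw [Real.norm_eq_abs, abs_of_nonneg (le_max_right _ _)]
    apply max_le _ (abs_nonneg _)
    have := neg_le_abs (Real.log (Real.sin (2 * Real.pi * s)))
    have : (0:ℝ) ≤ K := by positivity
    linarith
  · refine Eventually.of_forall fun s => ?_
    apply tendsto_const_nhds.congr'
    have := tendsto_natCast_atTop_atTop (R := ℝ)
    filter_upwards [this.eventually_ge_atTop (-Real.log (Real.sin (2 * Real.pi * s)))] with K hK
    rw [max_eq_right]; linarith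

lemma ee_re_im (t : ℝ) : ee t = Real.cos (2 * Real.pi * t) + Real.sin (2 * Real.pi * t) * Complex.I := by
  rw [ee, show (2 * Real.pi * Complex.I * t : ℂ) = ((2 * Real.pi * t : ℝ) : ℂ) * Complex.I by
    push_cast; ring, Complex.exp_mul_I]
  simp

lemma sin_bound (ρ : ℝ) (hρ : 0 ≤ ρ) (s a : ℝ) :
    max 1 ρ * |Real.sin (2 * Real.pi * (s - a))| ≤ ‖ee s - ρ * ee a‖ := by
  have h1 : ee s - ρ * ee a = (ee (s - a) - ρ) * ee a := by
    rw [sub_mul, ← ee_add]; simp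
  rw [h1, norm_mul, norm_ee, mul_one]
  set θ := 2 * Real.pi * (s - a) with hθ
  have h2 : ‖ee (s - a) - ρ‖ ^ 2 = (Real.cos θ - ρ) ^ 2 + Real.sin θ ^ 2 := by
    rw [ee_re_im, ← Complex.normSq_eq_norm_sq, Complex.normSq_apply, ← hθ]
    simp only [Complex.sub_re, Complex.sub_im, Complex.add_re, Complex.add_im, Complex.mul_re, Complex.mul_im,
      Complex.ofReal_re, Complex.ofReal_im, Complex.I_re, Complex.I_im]
    ring
  have hsc := Real.sin_sq_add_cos_sq θ
  apply le_of_sq_le_sq _ (norm_nonneg _) 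
  rw [mul_pow, sq_abs, h2]
  rcases le_total 1 ρ with h | h
  · rw [max_eq_right h]
    have : Real.sin θ ^ 2 = 1 - Real.cos θ ^ 2 := by linarith
    rw [this]
    nlinarith [sq_nonneg (1 - ρ * Real.cos θ)]
  · rw [max_eq_left h]; nlinarith [sq_nonneg (Real.cos θ - ρ)]

lemma exists_polar (α : ℂ) : ∃ a, α = ‖α‖ * ee a := by
  by_cases h : α = 0
  · exact ⟨0, by simp [h]⟩
  obtain ⟨a, ha⟩ := exists_ee (ζ := α / ‖α‖) (by simp [h])
  refine ⟨a, ?_⟩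
  rw [← ha]
  have : (‖α‖ : ℂ) ≠ 0 := by simpa using h
  field_simp

lemma tl_integrable (α : ℂ) : Integrable (tl α) nu := by
  have := mahler_integrable (X - C α)
  simp only [eval_sub, eval_X, eval_C] at this
  exact this.sub (integrable_const _)

lemma tl_integral (α : ℂ) : ∫ s, tl α s ∂nu = 0 := by
  have := mahler_integrable (X - C α)
  have h2 := mahler_eq (X - C α)
  simp only [eval_sub, eval_X, eval_C, logMahlerMeasure_X_sub_C] at this h2
  unfold tl
  rw [integral_sub this (integrable_const _), ← h2]
  simp

lemma posLog_eq (x : ℝ) (hx : 0 ≤ x) : Real.posLog x = Real.log (max 1 x) := by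
  change max 0 (Real.log x) = _
  rcases le_total 1 x with h | h
  · rw [max_eq_right h, max_eq_right (Real.log_nonneg h)]
  · rw [max_eq_left h, max_eq_left (Real.log_nonpos hx h)]; simp

lemma tl_trunc (α : ℂ) (K : ℝ) : ∫ s, max (tl α s) (-K) ∂nu ≤ eta K := by
  obtain ⟨a, ha⟩ := exists_polar α
  have hi1 := tl_integrable α
  have hi2 : Integrable (fun s => max (-Real.log (Real.sin (2 * Real.pi * (s - a))) - K) 0) nu :=
    ((integrable_log_sin a).neg.sub (integrable_const K)).sup (integrable_const (0:ℝ))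
  have hae : ∀ᵐ s ∂nu, max (tl α s) (-K) ≤ 
      tl α s + max (-Real.log (Real.sin (2 * Real.pi * (s - a))) - K) 0 := by
    have hf : ({ee a, -ee a} : Set ℂ).Finite := by simp
    filter_upwards [ae_nu_of_finite hf] with s hs
    have hsin : Real.sin (2 * Real.pi * (s - a)) ≠ 0 := by
      intro h0
      apply hs
      have h3 : ee s = ee (s - a) * ee a := by rw [← ee_add]; simp
      rw [h3, ee_re_im (s - a), h0]
      rcases Real.sin_eq_zero_iff_cos_eq.1 h0 with h | h <;> simp [h]
    have hb := sin_bound ‖α‖ (norm_nonneg _) s a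
    rw [← ha] at hb
    have hM : 0 < max 1 ‖α‖ := by positivity
    have hl := Real.log_le_log (by positivity) hb
    rw [Real.log_mul hM.ne' (by positivity), Real.log_abs] at hl
    have ht : Real.log (Real.sin (2 * Real.pi * (s - a))) ≤ tl α s := by
      rw [tl, posLog_eq _ (norm_nonneg _)]; linarith
    apply max_le
    · linarith [le_max_right (-Real.log (Real.sin (2 * Real.pi * (s - a))) - K) 0]
    · linarith [le_max_left (-Real.log (Real.sin (2 * Real.pi * (s - a))) - K) 0]
  calc _ ≤ ∫ s, (tl α s + max (-Real.log (Real.sin (2 * Real.pi * (s - a))) - K) 0) ∂nu :=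
        integral_mono_ae (hi1.sup (integrable_const _)) (hi1.add hi2) hae
    _ = eta K := by rw [integral_add hi1 hi2, tl_integral, eta_shift, zero_add]

lemma tl_le (α : ℂ) (s : ℝ) : tl α s ≤ Real.log 2 := by
  rw [tl, posLog_eq _ (norm_nonneg _)]
  have hM : 0 < max 1 ‖α‖ := by positivity
  by_cases h : ‖ee s - α‖ = 0
  · rw [h]; simp
    have := Real.log_nonneg (le_max_left 1 ‖α‖)
    have := Real.log_nonneg (one_le_two)
    linarith
  have h1 : ‖ee s - α‖ ≤ 2 * max 1 ‖α‖ := by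
    have := norm_sub_le (ee s) α
    rw [norm_ee] at this
    linarith [le_max_left 1 ‖α‖, le_max_right 1 ‖α‖]
  have h2 := Real.log_le_log (by positivity) h1
  rw [Real.log_mul (by norm_num) hM.ne'] at h2
  linarith

lemma log_eval_roots {Q : ℂ[X]} {s : ℝ} (hs : Q.eval (ee s) ≠ 0) :
    Real.log ‖Q.eval (ee s)‖ = Q.logMahlerMeasure + (Q.roots.map (fun α => tl α s)).sum := by
  have hQ : Q ≠ 0 := by rintro rfl; simp at hs
  have hsp := (IsAlgClosed.splits Q).eq_prod_roots
  have key : ∀ m : Multiset ℂ, ((C Q.leadingCoeff * (m.map (fun b => X - C b)).prod).eval (ee s) ≠ 0) →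
     Real.log ‖(C Q.leadingCoeff * (m.map (fun b => X - C b)).prod).eval (ee s)‖ = 
     Real.log ‖Q.leadingCoeff‖ + (m.map (fun a => Real.posLog ‖a‖)).sum + (m.map (fun α => tl α s)).sum := by
    intro m
    induction m using Multiset.induction with
    | empty => simp
    | cons b m ih =>
      intro h
      simp only [Multiset.map_cons, Multiset.prod_cons, Multiset.sum_cons] at h ⊢
      rw [show C Q.leadingCoeff * ((X - C b) * (m.map (fun b => X - C b)).prod) =
        (X - C b) * (C Q.leadingCoeff * (m.map (fun b => X - C b)).prod) by ring, eval_mul] at h ⊢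
      have h1 := left_ne_zero_of_mul h
      have h2 := right_ne_zero_of_mul h
      rw [norm_mul, Real.log_mul (by simpa using h1) (by simpa using h2), ih h2]
      simp only [eval_sub, eval_X, eval_C, tl]
      ring
  have := key Q.roots (by rwa [← hsp])
  rw [← hsp] at this
  rw [this, logMahlerMeasure_eq_log_leadingCoeff_add_sum_log_roots]

lemma log_eval_le {Q : ℂ[X]} {s : ℝ} (hs : Q.eval (ee s) ≠ 0) {N : ℕ} (hN : Q.natDegree ≤ N) :
    Real.log ‖Q.eval (ee s)‖ ≤ Q.logMahlerMeasure + N * Real.log 2 := by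
  rw [log_eval_roots hs]
  have h1 : (Q.roots.map (fun α => tl α s)).sum ≤ Multiset.card Q.roots • Real.log 2 := by
    have := Multiset.sum_le_card_nsmul (Q.roots.map (fun α => tl α s)) (Real.log 2) (by
      intro x hx
      obtain ⟨α, _, rfl⟩ := Multiset.mem_map.1 hx
      exact tl_le α s)
    simpa using this
  have h2 : (Multiset.card Q.roots : ℝ) ≤ N := by exact_mod_cast (card_roots' Q).trans hN
  have h3 := Real.log_nonneg (one_le_two)
  rw [nsmul_eq_mul] at h1
  nlinarith

lemma trunc_multiset (m : Multiset ℂ) {K : ℝ} (hK : 0 ≤ K) :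
    Integrable (fun s => (m.map (fun α => max (tl α s) (-K))).sum) nu ∧
    ∫ s, (m.map (fun α => max (tl α s) (-K))).sum ∂nu ≤ Multiset.card m * eta K ∧
    ∀ s, (m.map (fun α => tl α s)).sum ≤ (m.map (fun α => max (tl α s) (-K))).sum ∧ 
      -(K * Multiset.card m) ≤ (m.map (fun α => max (tl α s) (-K))).sum := by
  induction m using Multiset.induction with
  | empty => simp
  | cons b m ih =>
    obtain ⟨h1, h2, h3⟩ := ih
    simp only [Multiset.map_cons, Multiset.sum_cons, Multiset.card_cons]
    have hb : Integrable (fun s => max (tl b s) (-K)) nu := (tl_integrable b).sup (integrable_const _)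
    refine ⟨hb.add h1, ?_, fun s => ⟨add_le_add (le_max_left _ _) (h3 s).1, ?_⟩⟩
    · rw [integral_add hb h1]
      push_cast
      linarith [tl_trunc b K]
    · push_cast
      linarith [(h3 s).2, le_max_right (tl b s) (-K)]

lemma eta_nonneg (K : ℝ) : 0 ≤ eta K := integral_nonneg fun _ => le_max_right _ _

lemma trunc_bound {Q : ℂ[X]} (hQ : Q ≠ 0) {N : ℕ} (hN : Q.natDegree ≤ N) {K : ℝ} (hK : 0 ≤ K) :
    ∫ s, max (Real.log ‖Q.eval (ee s)‖) (Q.logMahlerMeasure - K * N) ∂nu ≤ 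
      Q.logMahlerMeasure + N * eta K := by
  obtain ⟨h1, h2, h3⟩ := trunc_multiset Q.roots hK
  have hc : (Multiset.card Q.roots : ℝ) ≤ N := by exact_mod_cast (card_roots' Q).trans hN
  calc _ ≤ ∫ s, (Q.logMahlerMeasure + (Q.roots.map (fun α => max (tl α s) (-K))).sum) ∂nu := by
        apply integral_mono_ae ((mahler_integrable Q).sup (integrable_const _)) 
          ((integrable_const _).add h1)
        filter_upwards [ae_eval_ne hQ] with s hs
        change max (Real.log ‖Q.eval (ee s)‖) (Q.logMahlerMeasure - K * N) ≤
          Q.logMahlerMeasure + (Q.roots.map (fun α => max (tl α s) (-K))).sum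
        rw [log_eval_roots hs]
        apply max_le
        · linarith [(h3 s).1]
        · have := (h3 s).2
          nlinarith
    _ = Q.logMahlerMeasure + ∫ s, (Q.roots.map (fun α => max (tl α s) (-K))).sum ∂nu := by
        rw [integral_add (integrable_const _) h1]; simp
    _ ≤ _ := by nlinarith [eta_nonneg K]

/-- The specialisation `g(·, w)` of a bivariate polynomial (outer variable `z`). -/
def gw (p : ℂ[X][X]) (w : ℂ) : ℂ[X] := p.map (evalRingHom w)

/-- `g(z, z^n)`. -/
def qn (p : ℂ[X][X]) (n : ℕ) : ℂ[X] := p.eval₂ (expand ℂ n : ℂ[X] →+* ℂ[X]) X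

lemma eval_qn (p : ℂ[X][X]) (n : ℕ) (z : ℂ) : (qn p n).eval z = (gw p (z ^ n)).eval z := by
  have h := hom_eval₂ p (expand ℂ n : ℂ[X] →+* ℂ[X]) (evalRingHom z) X
  have h2 : (evalRingHom z).comp (expand ℂ n : ℂ[X] →+* ℂ[X]) = evalRingHom (z ^ n) := by
    ext <;> simp
  rw [h2] at h
  simp only [coe_evalRingHom, eval_X] at h
  rw [qn, gw, eval_map]
  exact h

lemma natDegree_qn (p : ℂ[X][X]) (n d : ℕ) (hd : ∀ i, (p.coeff i).natDegree ≤ d) :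
    (qn p n).natDegree ≤ p.natDegree + n * d := by
  rw [qn, eval₂_eq_sum, Polynomial.sum]
  apply natDegree_sum_le_of_forall_le
  intro i hi
  refine natDegree_mul_le.trans ?_
  have h1 : i ≤ p.natDegree := le_natDegree_of_mem_supp i hi
  have h2 : ((expand ℂ n : ℂ[X] →+* ℂ[X]) (p.coeff i)).natDegree = (p.coeff i).natDegree * n :=
    natDegree_expand n _
  rw [h2]
  simp only [natDegree_X_pow]
  nlinarith [hd i, Nat.mul_le_mul_left n (hd i)]

/-- Product of all the rotates. -/
def Pn (p : ℂ[X][X]) (n : ℕ) : ℂ[X] := 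
  ∏ ζ ∈ nthRootsFinset n (1 : ℂ), (qn p n).comp (C ζ * X)

/-- The polynomial with `Qn(z^n) = ∏_ζ g(ζ z, z^n)`. -/
def Qn (p : ℂ[X][X]) (n : ℕ) : ℂ[X] := contract n (Pn p n)

lemma coeff_comp_scale (q : ℂ[X]) (a : ℂ) (i : ℕ) : (q.comp (C a * X)).coeff i = a ^ i * q.coeff i := by
  rw [comp_C_mul_X_coeff, mul_comm]

lemma Pn_rot (p : ℂ[X][X]) {n : ℕ} (hn : 0 < n) {ω : ℂ} (hω : ω ∈ nthRootsFinset n (1 : ℂ)) :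
    (Pn p n).comp (C ω * X) = Pn p n := by
  have hω1 : ω ^ n = 1 := (mem_nthRootsFinset hn _).1 hω
  have hω0 : ω ≠ 0 := by rintro rfl; simp [hn.ne'] at hω1
  rw [Pn, prod_comp]
  refine Finset.prod_bij' (fun ζ _ => ζ * ω) (fun ζ _ => ζ * ω⁻¹) ?_ ?_ ?_ ?_ ?_
  · intro ζ hζ
    rw [mem_nthRootsFinset hn] at hζ ⊢
    rw [mul_pow, hζ, hω1, one_mul]
  · intro ζ hζ
    rw [mem_nthRootsFinset hn] at hζ ⊢
    rw [mul_pow, hζ, inv_pow, hω1]; simp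
  · intro ζ _; field_simp
  · intro ζ _; field_simp
  · intro ζ _
    rw [comp_assoc]
    simp [← mul_assoc]

lemma expand_Qn (p : ℂ[X][X]) {n : ℕ} (hn : 0 < n) : expand ℂ n (Qn p n) = Pn p n := by
  have hprim := Complex.isPrimitiveRoot_exp n hn.ne'
  set ω := Complex.exp (2 * Real.pi * Complex.I / n)
  have hω : ω ∈ nthRootsFinset n (1 : ℂ) := (mem_nthRootsFinset hn _).2 hprim.pow_eq_one
  ext i
  rw [coeff_expand hn, Qn]
  split_ifs with h
  · rw [coeff_contract hn.ne', Nat.div_mul_cancel h]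
  · have h1 := congrArg (fun q => q.coeff i) (Pn_rot p hn hω)
    simp only [coeff_comp_scale] at h1
    have h2 : ω ^ i ≠ 1 := fun h3 => h (hprim.dvd_of_pow_eq_one i h3)
    have h3 : (ω ^ i - 1) * (Pn p n).coeff i = 0 := by rw [sub_mul, h1]; ring
    rcases mul_eq_zero.1 h3 with h4 | h4
    · exact absurd (sub_eq_zero.1 h4) h2
    · exact h4.symm

lemma card_roots_unity {n : ℕ} (hn : 0 < n) : (nthRootsFinset n (1 : ℂ)).card = n :=
  (Complex.isPrimitiveRoot_exp n hn.ne').card_nthRootsFinset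

lemma natDegree_Qn (p : ℂ[X][X]) {n : ℕ} (hn : 0 < n) (d : ℕ) (hd : ∀ i, (p.coeff i).natDegree ≤ d) :
    (Qn p n).natDegree ≤ n * (p.natDegree + d) := by
  have h1 : (Qn p n).natDegree * n = (Pn p n).natDegree := by
    rw [← expand_Qn p hn, natDegree_expand]
  have h2 : (Pn p n).natDegree ≤ n * (p.natDegree + n * d) := by
    rw [Pn]
    refine (natDegree_prod_le _ _).trans ?_
    calc _ ≤ ∑ _ζ ∈ nthRootsFinset n (1 : ℂ), (p.natDegree + n * d) :=
          Finset.sum_le_sum fun ζ _ => (natDegree_comp_scale _ _).trans (natDegree_qn p n d hd)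
      _ = _ := by rw [Finset.sum_const, card_roots_unity hn, smul_eq_mul]
  have h3 : (Qn p n).natDegree ≤ p.natDegree + n * d := by
    rw [← h1, mul_comm] at h2
    exact Nat.le_of_mul_le_mul_left h2 hn
  nlinarith

lemma norm_root_unity {n : ℕ} (hn : 0 < n) {ζ : ℂ} (h : ζ ∈ nthRootsFinset n (1 : ℂ)) : ‖ζ‖ = 1 :=
  Complex.norm_eq_one_of_pow_eq_one ((mem_nthRootsFinset hn _).1 h) hn.ne'

lemma mahler_Qn (p : ℂ[X][X]) {n : ℕ} (hn : 0 < n) :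
    (Qn p n).logMahlerMeasure = n * (qn p n).logMahlerMeasure := by
  rw [← mahler_expand _ hn.ne', expand_Qn p hn, logMahlerMeasure_eq_log_MahlerMeasure, Pn]
  have h : ∀ s : Finset ℂ, (∏ ζ ∈ s, (qn p n).comp (C ζ * X)).mahlerMeasure = 
      ∏ ζ ∈ s, ((qn p n).comp (C ζ * X)).mahlerMeasure := by
    intro s
    induction s using Finset.induction with
    | empty => simp
    | insert a s ha ih => rw [Finset.prod_insert ha, Finset.prod_insert ha, mahlerMeasure_mul, ih]
  rw [h]
  have h2 : ∀ ζ ∈ nthRootsFinset n (1 : ℂ), 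
      ((qn p n).comp (C ζ * X)).mahlerMeasure = (qn p n).mahlerMeasure := by
    intro ζ hζ
    by_cases h0 : qn p n = 0
    · simp [h0]
    have h1 : (qn p n).comp (C ζ * X) ≠ 0 := by
      intro h1
      apply h0
      ext i
      have h2 := congrArg (fun q => q.coeff i) h1
      simp only [coeff_comp_scale, coeff_zero] at h2
      have : ζ ≠ 0 := by 
        rintro rfl
        have := norm_root_unity hn hζ
        simp at this
      simpa [this] using h2
    rw [mahlerMeasure, mahlerMeasure, if_pos h1, if_pos h0, mahler_rot _ (norm_root_unity hn hζ)]
  rw [Finset.prod_congr rfl h2, Finset.prod_const, card_roots_unity hn, Real.log_pow,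
    logMahlerMeasure_eq_log_MahlerMeasure]

lemma eval_Qn (p : ℂ[X][X]) {n : ℕ} (hn : 0 < n) (z : ℂ) :
    (Qn p n).eval (z ^ n) = ∏ ζ ∈ nthRootsFinset n (1 : ℂ), (gw p (z ^ n)).eval (ζ * z) := by
  rw [← expand_eval, expand_Qn p hn, Pn, eval_prod]
  refine Finset.prod_congr rfl fun ζ hζ => ?_
  rw [eval_comp_scale, eval_qn, mul_pow, (mem_nthRootsFinset hn _).1 hζ, one_mul]

lemma norm_eval_Qn (p : ℂ[X][X]) {n : ℕ} (hn : 0 < n) (w : ℂ) :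
    ‖(Qn p n).eval w‖ = 
      ‖(gw p w).leadingCoeff‖ ^ n * ((gw p w).roots.map (fun α => ‖w - α ^ n‖)).prod := by
  obtain ⟨z, rfl⟩ := IsAlgClosed.exists_pow_nat_eq w hn
  rw [eval_Qn p hn]
  set g := gw p (z ^ n)
  have hsp := (IsAlgClosed.splits g).eq_prod_roots
  have hprim := Complex.isPrimitiveRoot_exp n hn.ne'
  have key : ∀ m : Multiset ℂ, ‖∏ ζ ∈ nthRootsFinset n (1 : ℂ), 
      (C g.leadingCoeff * (m.map (fun b => X - C b)).prod).eval (ζ * z)‖ = 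
      ‖g.leadingCoeff‖ ^ n * (m.map (fun α => ‖z ^ n - α ^ n‖)).prod := by
    intro m
    induction m using Multiset.induction with
    | empty => simp [Finset.prod_const, card_roots_unity hn]
    | cons b m ih =>
      simp only [Multiset.map_cons, Multiset.prod_cons]
      have e : ∀ ζ, (C g.leadingCoeff * ((X - C b) * (m.map (fun b => X - C b)).prod)).eval (ζ * z)
          = (ζ * z - b) * (C g.leadingCoeff * (m.map (fun b => X - C b)).prod).eval (ζ * z) := by
        intro ζ
        simp only [eval_mul, eval_sub, eval_X, eval_C]; ring
      simp only [e]
      rw [Finset.prod_mul_distrib, norm_mul, ih]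
      have h2 : ‖∏ ζ ∈ nthRootsFinset n (1 : ℂ), (ζ * z - b)‖ = ‖z ^ n - b ^ n‖ := by
        rw [norm_sub_rev, hprim.pow_sub_pow_eq_prod_sub_mul b z hn, norm_prod, norm_prod]
        exact Finset.prod_congr rfl fun ζ _ => norm_sub_rev _ _
      rw [h2]; ring
  have := key g.roots
  rw [← hsp] at this
  exact this

lemma tendsto_root {w α : ℂ} (hw : 1 < ‖w‖) :
    Tendsto (fun n : ℕ => Real.log ‖w - α ^ n‖ / n) atTop (𝓝 (Real.posLog ‖α‖)) ∧
    ∀ᶠ n : ℕ in atTop, w - α ^ n ≠ 0 := by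
  have hnat := tendsto_natCast_atTop_atTop (R := ℝ)
  have bdd : ∀ (f : ℕ → ℝ) (a b : ℝ), (∀ᶠ n in atTop, a ≤ f n ∧ f n ≤ b) →
      Tendsto (fun n : ℕ => f n / n) atTop (𝓝 0) := by
    intro f a b h
    have ha := (tendsto_const_nhds (x := a)).div_atTop hnat
    have hb := (tendsto_const_nhds (x := b)).div_atTop hnat
    apply tendsto_of_tendsto_of_tendsto_of_le_of_le' ha hb
    · filter_upwards [h] with n hn
      exact div_le_div_of_nonneg_right hn.1 (by positivity)
    · filter_upwards [h] with n hn
      exact div_le_div_of_nonneg_right hn.2 (by positivity)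
  rcases le_or_gt ‖α‖ 1 with h | h
  · have hp : ∀ n : ℕ, ‖α ^ n‖ ≤ 1 := fun n => by rw [norm_pow]; exact pow_le_one₀ (norm_nonneg _) h
    have hlow : ∀ n : ℕ, ‖w‖ - 1 ≤ ‖w - α ^ n‖ := fun n => by
      have := norm_sub_norm_le w (α ^ n)
      linarith [hp n]
    have hup : ∀ n : ℕ, ‖w - α ^ n‖ ≤ ‖w‖ + 1 := fun n => by
      have := norm_sub_le w (α ^ n)
      linarith [hp n]
    constructor
    · rw [posLog_eq _ (norm_nonneg _), max_eq_left h, Real.log_one]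
      apply bdd _ (Real.log (‖w‖ - 1)) (Real.log (‖w‖ + 1))
      refine Eventually.of_forall fun n => ⟨Real.log_le_log (by linarith) (hlow n), 
        Real.log_le_log (by linarith [hlow n]) (hup n)⟩
    · refine Eventually.of_forall fun n h0 => ?_
      have := hlow n
      rw [h0] at this
      simp at this; linarith
  · have hp : Tendsto (fun n : ℕ => ‖α‖ ^ n) atTop atTop := tendsto_pow_atTop_atTop_of_one_lt h
    have hb : ∀ᶠ n : ℕ in atTop, ‖α‖ ^ n / 2 ≤ ‖w - α ^ n‖ ∧ ‖w - α ^ n‖ ≤ 2 * ‖α‖ ^ n := by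
      filter_upwards [hp.eventually_ge_atTop (2 * ‖w‖)] with n hn
      have h1 := norm_sub_norm_le (α ^ n) w
      have h2 := norm_sub_le w (α ^ n)
      rw [norm_sub_rev] at h1
      rw [norm_pow] at h1 h2
      constructor <;> linarith [norm_nonneg w]
    have hpos : ∀ n : ℕ, 0 < ‖α‖ ^ n := fun n => by positivity
    constructor
    · rw [posLog_eq _ (norm_nonneg _), max_eq_right h.le]
      have := bdd (fun n => Real.log ‖w - α ^ n‖ - n * Real.log ‖α‖) (-Real.log 2) (Real.log 2) (by
        filter_upwards [hb] with n hn
        have h1 := Real.log_le_log (by have := hpos n; positivity) hn.1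
        have h2 := Real.log_le_log (by linarith [hpos n]) hn.2
        rw [Real.log_div (hpos n).ne' (by norm_num), Real.log_pow] at h1
        rw [Real.log_mul (by norm_num) (hpos n).ne', Real.log_pow] at h2
        constructor <;> linarith)
      have h3 := this.add_const (Real.log ‖α‖)
      rw [zero_add] at h3
      refine h3.congr' ?_
      filter_upwards [eventually_gt_atTop 0] with n hn
      have : (n : ℝ) ≠ 0 := by positivity
      field_simp
      ring
    · filter_upwards [hb] with n hn h0
      have hn1 := hn.1
      rw [h0, norm_zero] at hn1
      linarith [hpos n]

/-- Pointwise convergence. -/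
lemma tendsto_Qn (p : ℂ[X][X]) {w : ℂ} (hw : 1 < ‖w‖) (hg : gw p w ≠ 0) :
    Tendsto (fun n : ℕ => Real.log ‖(Qn p n).eval w‖ / n) atTop (𝓝 (gw p w).logMahlerMeasure) ∧
    ∀ᶠ n : ℕ in atTop, (Qn p n).eval w ≠ 0 := by
  set g := gw p w with hgdef
  have hl : g.leadingCoeff ≠ 0 := leadingCoeff_ne_zero.2 hg
  have key : ∀ m : Multiset ℂ, 
      Tendsto (fun n : ℕ => Real.log (‖g.leadingCoeff‖ ^ n * (m.map (fun α => ‖w - α ^ n‖)).prod) / n) 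
        atTop (𝓝 (Real.log ‖g.leadingCoeff‖ + (m.map (fun a => Real.posLog ‖a‖)).sum)) ∧
      ∀ᶠ n : ℕ in atTop, ‖g.leadingCoeff‖ ^ n * (m.map (fun α => ‖w - α ^ n‖)).prod ≠ 0 := by
    intro m
    induction m using Multiset.induction with
    | empty => 
      constructor
      · simp only [Multiset.map_zero, Multiset.prod_zero, Multiset.sum_zero, mul_one, add_zero]
        apply tendsto_const_nhds.congr'
        filter_upwards [eventually_gt_atTop 0] with n hn
        have : (n : ℝ) ≠ 0 := by positivity
        rw [Real.log_pow]; field_simp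
      · simp [hl]
    | cons b m ih =>
      obtain ⟨h1, h2⟩ := ih
      obtain ⟨h3, h4⟩ := tendsto_root (α := b) hw
      simp only [Multiset.map_cons, Multiset.prod_cons, Multiset.sum_cons]
      constructor
      · have := h3.add h1
        rw [show Real.log ‖g.leadingCoeff‖ + (Real.posLog ‖b‖ + (m.map (fun a => Real.posLog ‖a‖)).sum)
          = Real.posLog ‖b‖ + (Real.log ‖g.leadingCoeff‖ + (m.map (fun a => Real.posLog ‖a‖)).sum) by ring]
        refine this.congr' ?_
        filter_upwards [h2, h4] with n hn2 hn4
        rw [mul_left_comm, Real.log_mul (by simpa using hn4) hn2, add_div]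
      · filter_upwards [h2, h4] with n hn2 hn4
        rw [mul_left_comm]
        exact mul_ne_zero (by simpa using hn4) hn2
  obtain ⟨h1, h2⟩ := key g.roots
  constructor
  · rw [logMahlerMeasure_eq_log_leadingCoeff_add_sum_log_roots]
    refine h1.congr' ?_
    filter_upwards [eventually_gt_atTop 0] with n hn
    rw [norm_eval_Qn p hn]
  · filter_upwards [eventually_gt_atTop 0, h2] with n hn hn2
    rw [← norm_ne_zero_iff, norm_eval_Qn p hn]
    exact hn2


lemma eval_gw_sum (p : ℂ[X][X]) (w z : ℂ) :
    (gw p w).eval z = ∑ i ∈ p.support, (p.coeff i).eval w * z ^ i := by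
  rw [gw, eval_map, eval₂_eq_sum, Polynomial.sum]; rfl

lemma cont_gw (p : ℂ[X][X]) : Continuous fun x : ℂ × ℂ => (gw p x.2).eval x.1 := by
  simp only [eval_gw_sum]
  refine continuous_finsetSum _ fun i _ => ?_
  have := (p.coeff i).continuous
  fun_prop

lemma gw_bound (p : ℂ[X][X]) (R : ℝ) : 
    ∃ B : ℝ, 1 ≤ B ∧ ∀ z w : ℂ, ‖z‖ ≤ R → ‖w‖ ≤ R → ‖(gw p w).eval z‖ ≤ B := by
  have hc : IsCompact (Metric.closedBall (0:ℂ) R ×ˢ Metric.closedBall (0:ℂ) R) :=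
    (isCompact_closedBall _ _).prod (isCompact_closedBall _ _)
  obtain ⟨B, hB⟩ := hc.exists_bound_of_continuousOn (cont_gw p).continuousOn
  refine ⟨max 1 B, le_max_left _ _, fun z w hz hw => (hB (z, w) ?_).trans (le_max_right _ _)⟩
  simp [hz, hw]

lemma Qn_bound (p : ℂ[X][X]) {R : ℝ} (hR : 1 ≤ R) : 
    ∃ B : ℝ, 0 ≤ B ∧ ∀ n : ℕ, 0 < n → ∀ w : ℂ, ‖w‖ = R → Real.log ‖(Qn p n).eval w‖ / n ≤ B := by
  obtain ⟨B, hB1, hB⟩ := gw_bound p R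
  refine ⟨Real.log B, Real.log_nonneg hB1, fun n hn w hw => ?_⟩
  obtain ⟨z, rfl⟩ := IsAlgClosed.exists_pow_nat_eq w hn
  have hz : ‖z‖ ≤ R := by
    by_contra! h
    have h1 : ‖z‖ ^ 1 ≤ ‖z‖ ^ n := pow_le_pow_right₀ (by linarith) hn
    rw [norm_pow] at hw
    rw [hw] at h1; linarith
  have hn' : (0:ℝ) < n := by exact_mod_cast hn
  rw [div_le_iff₀ hn']
  by_cases h0 : ‖(Qn p n).eval (z ^ n)‖ = 0
  · rw [h0, Real.log_zero]; exact mul_nonneg (Real.log_nonneg hB1) hn'.le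
  have h2 : ‖(Qn p n).eval (z ^ n)‖ ≤ B ^ n := by
    rw [eval_Qn p hn, norm_prod]
    calc _ ≤ ∏ _ζ ∈ nthRootsFinset n (1 : ℂ), B := by
          apply Finset.prod_le_prod (fun _ _ => norm_nonneg _)
          intro ζ hζ
          apply hB _ _ _ hw.le
          rw [norm_mul, norm_root_unity hn hζ, one_mul]; exact hz
      _ = B ^ n := by rw [Finset.prod_const, card_roots_unity hn]
  have h3 := Real.log_le_log (by positivity) h2
  rw [Real.log_pow] at h3
  linarith

/-- Integrability of the logarithm of a family of polynomials. -/
lemma step_integrable {Ω : Type*} [MeasurableSpace Ω] (μ : Measure Ω) [IsProbabilityMeasure μ]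
    (f : Ω × ℝ → ℂ) (hf : Measurable f) (h : Ω → ℂ[X]) 
    (hfh : ∀ x s, ‖f (x, s)‖ = ‖(h x).eval (ee s)‖) (B : ℝ) (hB : 1 ≤ B) (hfB : ∀ y, ‖f y‖ ≤ B)
    (c : Ω → ℂ) (hc : ∀ᵐ x ∂μ, c x ≠ 0) (hcl : ∀ x, c x ≠ 0 → (h x).leadingCoeff = c x)
    (hci : Integrable (fun x => Real.log ‖c x‖) μ) :
    Integrable (fun y => Real.log ‖f y‖) (μ.prod nu) ∧ (∀ᵐ y ∂(μ.prod nu), f y ≠ 0) := by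
  have hm : Measurable (fun y => Real.log ‖f y‖) := hf.norm.log
  constructor
  · rw [integrable_prod_iff hm.aestronglyMeasurable]
    constructor
    · refine Eventually.of_forall fun x => ?_
      simp only [hfh]
      exact mahler_integrable (h x)
    · have hb : Integrable (fun x => 2 * Real.log B - Real.log ‖c x‖) μ := (integrable_const _).sub hci
      refine hb.mono' ?_ ?_
      · exact hm.aestronglyMeasurable.norm.integral_prod_right'
      · filter_upwards [hc] with x hx
        rw [Real.norm_eq_abs, abs_of_nonneg (integral_nonneg fun _ => norm_nonneg _)]
        have hi := mahler_integrable (h x)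
        simp only [hfh]
        have hlB := Real.log_nonneg hB
        calc _ ≤ ∫ s, (2 * Real.log B - Real.log ‖(h x).eval (ee s)‖) ∂nu := by
              apply integral_mono hi.norm ((integrable_const _).sub hi)
              intro s
              change |Real.log ‖(h x).eval (ee s)‖| ≤ 2 * Real.log B - Real.log ‖(h x).eval (ee s)‖
              have h1 : Real.log ‖(h x).eval (ee s)‖ ≤ Real.log B := by
                by_cases h0 : ‖(h x).eval (ee s)‖ = 0
                · rw [h0, Real.log_zero]; exact hlB
                · apply Real.log_le_log (by positivity)
                  rw [← hfh]; exact hfB _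
              rw [abs_le]; constructor <;> linarith
          _ = 2 * Real.log B - (h x).logMahlerMeasure := by
              rw [integral_sub (integrable_const _) hi, ← mahler_eq]; simp
          _ ≤ _ := by
              have h2 := leadingCoeff_le_mahlerMeasure (h x)
              rw [hcl x hx] at h2
              have h3 := Real.log_le_log (by simpa using hx) h2
              rw [← logMahlerMeasure_eq_log_MahlerMeasure] at h3
              linarith
  · rw [ae_iff]
    simp only [not_not]
    have hms : MeasurableSet {y | f y = 0} := hf (measurableSet_singleton 0)
    rw [Measure.measure_prod_null hms]
    filter_upwards [hc] with x hx
    have hne : h x ≠ 0 := by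
      intro h0
      apply hx
      rw [← hcl x hx, h0]; simp
    have := ae_eval_ne hne
    rw [ae_iff] at this
    simp only [not_not] at this
    refine Eq.trans ?_ this
    congr 1
    ext s
    simp only [Set.mem_preimage, Set.mem_ofPred_eq]
    rw [← norm_eq_zero, hfh, norm_eq_zero]

lemma norm_R_ee {R : ℝ} (hR : 1 ≤ R) (u : ℝ) : ‖(R : ℂ) * ee u‖ = R := by
  rw [norm_mul, norm_ee, mul_one, Complex.norm_real, Real.norm_eq_abs, abs_of_pos (by linarith)]

lemma integrable_gw (p : ℂ[X][X]) {R : ℝ} (hR : 1 ≤ R) :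
    Integrable (fun y : ℝ × ℝ => Real.log ‖(gw p (R * ee y.1)).eval (ee y.2)‖) (nu.prod nu) := by
  by_cases hp : p = 0
  · simp [hp, gw]
  obtain ⟨B, hB1, hB⟩ := gw_bound p R
  have hl : p.leadingCoeff ≠ 0 := leadingCoeff_ne_zero.2 hp
  refine (step_integrable nu (fun y : ℝ × ℝ => (gw p (R * ee y.1)).eval (ee y.2)) ?_ 
    (fun u => gw p (R * ee u)) (fun _ _ => rfl) B hB1 ?_ 
    (fun u => (p.leadingCoeff.comp (C (R : ℂ) * X)).eval (ee u)) 
    (ae_eval_ne (comp_scale_ne hl hR)) ?_ (mahler_integrable _)).1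
  · have h1 : Continuous fun y : ℝ × ℝ => (ee y.2, (R : ℂ) * ee y.1) := by
      have := continuous_ee
      fun_prop
    exact ((cont_gw p).comp h1).measurable
  · intro y
    apply hB
    · rw [norm_ee]; exact hR
    · exact (norm_R_ee hR _).le
  · intro u hu
    rw [eval_comp_scale] at hu ⊢
    exact leadingCoeff_map_of_leadingCoeff_ne_zero (evalRingHom ((R : ℂ) * ee u)) hu

/-- Average over the circle of radius `R` of the Mahler measures of the specialisations. -/
def VR (p : ℂ[X][X]) (R : ℝ) : ℝ := ∫ u, (gw p (R * ee u)).logMahlerMeasure ∂nu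

lemma VR_integrable (p : ℂ[X][X]) {R : ℝ} (hR : 1 ≤ R) : 
    Integrable (fun u => (gw p (R * ee u)).logMahlerMeasure) nu := by
  simp only [mahler_eq]
  exact (integrable_gw p hR).integral_prod_left

lemma eval_swap (p : ℂ[X][X]) (z w : ℂ) : (gw p w).eval z = (p.eval (C z)).eval w := by
  rw [eval_gw_sum, eval_eq_sum (p := p), Polynomial.sum, eval_finsetSum]
  simp

lemma gw_slice (p : ℂ[X][X]) (R u s : ℝ) : 
    (gw p (R * ee u)).eval (ee s) = ((p.eval (C (ee s))).comp (C (R : ℂ) * X)).eval (ee u) := by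
  rw [eval_comp_scale, eval_swap]

lemma VR_swap (p : ℂ[X][X]) {R : ℝ} (hR : 1 ≤ R) :
    VR p R = ∫ s, ((p.eval (C (ee s))).comp (C (R : ℂ) * X)).logMahlerMeasure ∂nu ∧
    Integrable (fun s => ((p.eval (C (ee s))).comp (C (R : ℂ) * X)).logMahlerMeasure) nu := by
  have hi := integrable_gw p hR
  constructor
  · simp only [VR, mahler_eq]
    rw [integral_integral_swap hi]
    simp only [gw_slice]
  · have := hi.integral_prod_right
    simp only [gw_slice] at this
    simpa only [mahler_eq] using this

lemma natDegree_slice (p : ℂ[X][X]) (z : ℂ) (d : ℕ) (hd : ∀ i, (p.coeff i).natDegree ≤ d) :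
    (p.eval (C z)).natDegree ≤ d := by
  rw [eval_eq_sum, Polynomial.sum]
  apply natDegree_sum_le_of_forall_le
  intro i _
  rw [← C_pow]
  refine (natDegree_mul_C_le _ _).trans (hd i)

lemma VR_bounds (p : ℂ[X][X]) {R : ℝ} (hR : 1 ≤ R) (d : ℕ) (hd : ∀ i, (p.coeff i).natDegree ≤ d) :
    VR p 1 ≤ VR p R ∧ VR p R ≤ VR p 1 + d * Real.log R := by
  obtain ⟨h1, i1⟩ := VR_swap p (le_refl (1:ℝ))
  obtain ⟨h2, i2⟩ := VR_swap p hR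
  simp only [Complex.ofReal_one, map_one, one_mul, comp_X] at h1 i1
  rw [h1, h2]
  have hl := Real.log_nonneg hR
  constructor
  · exact integral_mono i1 i2 fun s => (mahler_scale _ hR).1
  · have : ∫ s, ((p.eval (C (ee s))).logMahlerMeasure + d * Real.log R) ∂nu = 
        ∫ s, (p.eval (C (ee s))).logMahlerMeasure ∂nu + d * Real.log R := by
      rw [integral_add i1 (integrable_const _)]; simp
    rw [← this]
    refine integral_mono i2 (i1.add (integrable_const _)) fun s => ?_
    refine (mahler_scale _ hR).2.trans ?_
    have : ((p.eval (C (ee s))).natDegree : ℝ) ≤ d := by exact_mod_cast natDegree_slice p _ d hd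
    change _ ≤ (p.eval (C (ee s))).logMahlerMeasure + d * Real.log R
    nlinarith

lemma LR (p : ℂ[X][X]) (hp : p ≠ 0) {R : ℝ} (hR : 1 < R) (d : ℕ) 
    (hd : ∀ i, (p.coeff i).natDegree ≤ d) :
    Tendsto (fun n : ℕ => ((Qn p n).comp (C (R : ℂ) * X)).logMahlerMeasure / n) atTop 
      (𝓝 (VR p R)) := by
  set Qt : ℕ → ℂ[X] := fun n => (Qn p n).comp (C (R : ℂ) * X) with hQt
  set D : ℕ := p.natDegree + d + 1 with hD
  set v : ℕ → ℝ → ℝ := fun n u => Real.log ‖(Qt n).eval (ee u)‖ / n with hv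
  set vi : ℝ → ℝ := fun u => (gw p (R * ee u)).logMahlerMeasure with hvi
  have hvint : ∀ n, Integrable (v n) nu := fun n => (mahler_integrable (Qt n)).div_const _
  have hviint : Integrable vi nu := VR_integrable p hR.le
  have hmn : ∀ n, (Qt n).logMahlerMeasure / n = ∫ u, v n u ∂nu := by
    intro n
    rw [mahler_eq, hv]; simp only; rw [integral_div]
  have hdeg : ∀ n, 0 < n → (Qt n).natDegree ≤ n * D := by
    intro n hn
    refine (natDegree_comp_scale _ _).trans ((natDegree_Qn p hn d hd).trans ?_)
    exact Nat.mul_le_mul_left n (by omega)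
  have hQe : ∀ n u, (Qt n).eval (ee u) = (Qn p n).eval (R * ee u) := fun n u => eval_comp_scale _ _ _
  have hl : p.leadingCoeff ≠ 0 := leadingCoeff_ne_zero.2 hp
  have hgne : ∀ᵐ u ∂nu, gw p (R * ee u) ≠ 0 := by
    filter_upwards [ae_eval_ne (comp_scale_ne hl hR.le)] with u hu h0
    rw [eval_comp_scale] at hu
    have := leadingCoeff_map_of_leadingCoeff_ne_zero (p := p) (evalRingHom ((R : ℂ) * ee u)) hu
    change (gw p (R * ee u)).leadingCoeff = _ at this
    rw [h0, leadingCoeff_zero] at this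
    exact hu this.symm
  have hw : ∀ u, 1 < ‖(R : ℂ) * ee u‖ := fun u => by rw [norm_R_ee hR.le]; exact hR
  have hpt : ∀ᵐ u ∂nu, Tendsto (fun n => v n u) atTop (𝓝 (vi u)) := by
    filter_upwards [hgne] with u hu
    have := (tendsto_Qn p (hw u) hu).1
    simpa only [hv, hQe] using this
  obtain ⟨u0, hu0⟩ := hgne.exists
  obtain ⟨t0, n0⟩ := tendsto_Qn p (hw u0) hu0
  set B' : ℝ := -(vi u0 - 1 - D * Real.log 2) with hB'
  have hlow : ∀ᶠ n : ℕ in atTop, Qt n ≠ 0 ∧ -B' ≤ (Qt n).logMahlerMeasure / n := by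
    filter_upwards [n0, t0.eventually (lt_mem_nhds (show vi u0 - 1 < _ from sub_one_lt _)), 
      eventually_gt_atTop 0] with n hn1 hn2 hn3
    rw [← hQe] at hn1 hn2
    refine ⟨fun h0 => hn1 (by rw [h0]; simp), ?_⟩
    have h1 := log_eval_le hn1 (hdeg n hn3)
    have hn' : (0:ℝ) < n := by exact_mod_cast hn3
    rw [le_div_iff₀ hn']
    rw [lt_div_iff₀ hn'] at hn2
    push_cast at h1
    rw [hB']
    nlinarith
  obtain ⟨B, hB0, hB⟩ := Qn_bound p hR.le
  set T : ℕ → ℝ := fun K => B' + K * D with hT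
  have hTtop : Tendsto T atTop atTop := by
    apply tendsto_atTop_add_const_left
    apply Tendsto.atTop_mul_const (by positivity)
    exact tendsto_natCast_atTop_atTop
  have hW : ∀ t : ℝ, Tendsto (fun n => ∫ u, max (v n u) (-t) ∂nu) atTop (𝓝 (∫ u, max (vi u) (-t) ∂nu)) := by
    intro t
    apply tendsto_integral_filter_of_dominated_convergence (fun _ => B + |t|)
    · exact Eventually.of_forall fun n => ((hvint n).sup (integrable_const (-t))).aestronglyMeasurable
    · filter_upwards [eventually_gt_atTop 0] with n hn
      refine Eventually.of_forall fun u => ?_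
      have h1 : v n u ≤ B := by
        have := hB n hn (R * ee u) (norm_R_ee hR.le u)
        rw [← hQe] at this
        exact this
      rw [Real.norm_eq_abs, abs_le]
      constructor
      · have := le_max_right (v n u) (-t)
        linarith [le_abs_self t]
      · apply max_le
        · linarith [abs_nonneg t]
        · linarith [neg_le_abs t]
    · exact integrable_const _
    · filter_upwards [hpt] with u hu
      exact hu.max tendsto_const_nhds
  have hWT : Tendsto (fun K => ∫ u, max (vi u) (-(T K)) ∂nu) atTop (𝓝 (VR p R)) := by
    apply tendsto_integral_filter_of_dominated_convergence (fun u => |vi u|)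
    · exact Eventually.of_forall fun n => (hviint.sup (integrable_const _)).aestronglyMeasurable
    · filter_upwards [hTtop.eventually_ge_atTop 0] with K hK
      refine Eventually.of_forall fun u => ?_
      rw [Real.norm_eq_abs, abs_le]
      constructor
      · have := le_max_left (vi u) (-(T K))
        linarith [neg_abs_le (vi u)]
      · apply max_le (le_abs_self _)
        linarith [abs_nonneg (vi u)]
    · exact hviint.abs
    · refine Eventually.of_forall fun u => ?_
      apply tendsto_const_nhds.congr'
      filter_upwards [hTtop.eventually_ge_atTop (-vi u)] with K hK
      rw [max_eq_left]; linarith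
  have hge : ∀ t, VR p R ≤ ∫ u, max (vi u) (-t) ∂nu := fun t =>
    integral_mono hviint (hviint.sup (integrable_const _)) fun u => le_max_left _ _
  rw [Metric.tendsto_atTop]
  intro ε hε
  have heta : Tendsto (fun K : ℕ => D * eta K) atTop (𝓝 0) := by
    have := eta_tendsto.const_mul (D : ℝ)
    simpa using this
  obtain ⟨K, hK1, hK2⟩ := ((heta.eventually (gt_mem_nhds (half_pos hε))).and 
    (hWT.eventually (gt_mem_nhds (show VR p R < VR p R + ε / 2 by linarith)))).exists
  have h3 := (Metric.tendsto_nhds.1 (hW (T K)) (ε / 2) (half_pos hε))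
  have h4 : ∀ᶠ n : ℕ in atTop, dist ((Qt n).logMahlerMeasure / n) (VR p R) < ε := by
    filter_upwards [h3, hlow, eventually_gt_atTop 0] with n hn1 hn2 hn3
    have hn' : (0:ℝ) < n := by exact_mod_cast hn3
    have a1 : (Qt n).logMahlerMeasure / n ≤ ∫ u, max (v n u) (-(T K)) ∂nu := by
      rw [hmn]
      exact integral_mono (hvint n) ((hvint n).sup (integrable_const _)) fun u => le_max_left _ _
    have a2 : ∫ u, max (v n u) (-(T K)) ∂nu ≤ (Qt n).logMahlerMeasure / n + D * eta K := by
      have h5 := trunc_bound hn2.1 (hdeg n hn3) (K := K) (by positivity)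
      have h6 : ∫ u, max (v n u) (-(T K)) ∂nu ≤ 
          (∫ s, max (Real.log ‖(Qt n).eval (ee s)‖) ((Qt n).logMahlerMeasure - K * (n * D : ℕ)) ∂nu) / n := by
        rw [← integral_div]
        apply integral_mono ((hvint n).sup (integrable_const _))
        · exact ((mahler_integrable (Qt n)).sup (integrable_const _)).div_const _
        · intro u
          change max (v n u) (-(T K)) ≤ 
            max (Real.log ‖(Qt n).eval (ee u)‖) ((Qt n).logMahlerMeasure - K * (n * D : ℕ)) / n
          apply max_le
          · exact div_le_div_of_nonneg_right (le_max_left _ _) hn'.le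
          · refine le_trans ?_ (div_le_div_of_nonneg_right (le_max_right _ _) hn'.le)
            rw [sub_div]
            have : (K * (n * D : ℕ) : ℝ) / n = K * D := by push_cast; field_simp
            rw [this, hT]
            simp only
            linarith [hn2.2]
      refine h6.trans ?_
      rw [div_le_iff₀ hn']
      refine h5.trans (le_of_eq ?_)
      push_cast
      field_simp
    rw [Real.dist_eq, abs_lt] at hn1 ⊢
    have := hge (T K)
    constructor <;> linarith [hn1.1, hn1.2]
  exact eventually_atTop.1 h4

/-- The two-variable limit theorem. -/
theorem main_two (p : ℂ[X][X]) : 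
    Tendsto (fun n : ℕ => (qn p n).logMahlerMeasure) atTop 
      (𝓝 (∫ u, (gw p (ee u)).logMahlerMeasure ∂nu)) := by
  by_cases hp : p = 0
  · simp [hp, qn, gw]
  have hV : ∫ u, (gw p (ee u)).logMahlerMeasure ∂nu = VR p 1 := by simp [VR]
  rw [hV]
  set d : ℕ := p.support.sup (fun i => (p.coeff i).natDegree)
  have hd : ∀ i, (p.coeff i).natDegree ≤ d := by
    intro i
    by_cases hi : i ∈ p.support
    · exact Finset.le_sup (f := fun i => (p.coeff i).natDegree) hi
    · simp [notMem_support_iff.1 hi]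
  set D : ℕ := p.natDegree + d + 1 with hD
  have hD0 : (0:ℝ) < D := by positivity
  rw [Metric.tendsto_atTop]
  intro ε hε
  set R := Real.exp (ε / (4 * D)) with hRdef
  have hR : 1 < R := Real.one_lt_exp_iff.2 (by positivity)
  have hlog : D * Real.log R = ε / 4 := by
    rw [hRdef, Real.log_exp]; field_simp
  have hlR := Real.log_nonneg hR.le
  obtain ⟨b1, b2⟩ := VR_bounds p hR.le d hd
  have hdD : (d : ℝ) ≤ D := by rw [hD]; push_cast; linarith [(Nat.cast_nonneg p.natDegree : (0:ℝ) ≤ _)]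
  have b3 : d * Real.log R ≤ ε / 4 := by nlinarith
  have h4 : ∀ᶠ n : ℕ in atTop, dist (qn p n).logMahlerMeasure (VR p 1) < ε := by
    filter_upwards [Metric.tendsto_nhds.1 (LR p hp hR d hd) (ε / 4) (by positivity), 
      eventually_gt_atTop 0] with n hn1 hn
    have hn' : (0:ℝ) < n := by exact_mod_cast hn
    obtain ⟨c1, c2⟩ := mahler_scale (Qn p n) hR.le
    have hq : (qn p n).logMahlerMeasure = (Qn p n).logMahlerMeasure / n := by
      rw [mahler_Qn p hn]; field_simp
    have c3 : (qn p n).logMahlerMeasure ≤ ((Qn p n).comp (C (R : ℂ) * X)).logMahlerMeasure / n := by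
      rw [hq]; exact div_le_div_of_nonneg_right c1 hn'.le
    have c4 : ((Qn p n).comp (C (R : ℂ) * X)).logMahlerMeasure / n ≤ (qn p n).logMahlerMeasure + ε / 4 := by
      rw [hq, div_le_iff₀ hn', add_mul, div_mul_cancel₀ _ hn'.ne']
      refine c2.trans ?_
      have e1 : ((Qn p n).natDegree : ℝ) ≤ n * D := by
        have := (natDegree_Qn p hn d hd).trans (Nat.mul_le_mul_left n (show p.natDegree + d ≤ D by omega))
        exact_mod_cast this
      have : ((Qn p n).natDegree : ℝ) * Real.log R ≤ n * D * Real.log R := 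
        mul_le_mul_of_nonneg_right e1 hlR
      rw [mul_assoc, hlog] at this
      linarith
    rw [Real.dist_eq, abs_lt] at hn1 ⊢
    constructor <;> linarith [hn1.1, hn1.2]
  exact eventually_atTop.1 h4

/-- Evaluation of a Laurent polynomial at the torus point with angles `t`. -/
def E {k : ℕ} (G : LPoly k) (t : Fin k → ℝ) : ℂ :=
  G.sum fun e c => c * ee (∑ i, (e i : ℝ) * t i)

lemma ee_sum {ι : Type*} (S : Finset ι) (f : ι → ℝ) : ee (∑ i ∈ S, f i) = ∏ i ∈ S, ee (f i) := by
  classical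
  induction S using Finset.induction_on with
  | empty => simp [ee_zero]
  | insert a S ha ih => rw [Finset.sum_insert ha, Finset.prod_insert ha, ee_add, ih]

lemma evalT_eq {k : ℕ} (G : LPoly k) (t : Fin k → ℝ) : evalT G (torusPt t) = E G t := by
  unfold evalT E Finsupp.sum
  refine Finset.sum_congr rfl fun e _ => ?_
  change _ = G e * ee (∑ i, (e i : ℝ) * t i)
  rw [ee_sum]
  congr 1
  refine Finset.prod_congr rfl fun i _ => ?_
  rw [ee_int_mul]
  rfl

lemma continuous_E {k : ℕ} (G : LPoly k) : Continuous (E G) := by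
  unfold E Finsupp.sum
  refine continuous_finsetSum _ fun e _ => ?_
  refine continuous_const.mul (continuous_ee.comp ?_)
  fun_prop

/-- A bound for the values on the torus. -/
def Bd {k : ℕ} (G : LPoly k) : ℝ := 1 + G.sum fun _ c => ‖c‖

lemma one_le_Bd {k : ℕ} (G : LPoly k) : 1 ≤ Bd G := by
  have : 0 ≤ G.sum fun _ c => ‖c‖ := Finset.sum_nonneg fun _ _ => norm_nonneg _
  unfold Bd; linarith

lemma norm_E_le {k : ℕ} (G : LPoly k) (t : Fin k → ℝ) : ‖E G t‖ ≤ Bd G := by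
  have : ‖E G t‖ ≤ G.sum fun _ c => ‖c‖ := by
    unfold E Finsupp.sum
    refine (norm_sum_le _ _).trans (Finset.sum_le_sum fun e _ => ?_)
    rw [norm_mul, norm_ee, mul_one]
  unfold Bd; linarith

lemma E_substM {l k : ℕ} (A : Matrix (Fin l) (Fin k) ℤ) (G : LPoly k) (t : Fin l → ℝ) :
    E (substM A G) t = E G (fun j => ∑ i, (A i j : ℝ) * t i) := by
  unfold E substM
  rw [Finsupp.sum_mapDomain_index (by simp) (by intros; ring)]
  refine Finsupp.sum_congr fun e _ => ?_
  congr 2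
  simp only [substExp, Int.cast_sum, Int.cast_mul, Finset.sum_mul, Finset.mul_sum]
  rw [Finset.sum_comm]
  refine Finset.sum_congr rfl fun i _ => Finset.sum_congr rfl fun j _ => ?_
  ring

lemma substM_substM {m l k : ℕ} (B : Matrix (Fin m) (Fin l) ℤ) (A : Matrix (Fin l) (Fin k) ℤ)
    (G : LPoly k) : substM B (substM A G) = substM (B * A) G := by
  unfold substM
  rw [← Finsupp.mapDomain_comp]
  congr 1
  ext e i
  simp only [Function.comp, substExp, Matrix.mul_apply, Finset.mul_sum, Finset.sum_mul]
  rw [Finset.sum_comm]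
  refine Finset.sum_congr rfl fun i _ => Finset.sum_congr rfl fun j _ => ?_
  ring

/-- The uniform measure on the cube. -/
def mu (k : ℕ) : Measure (Fin k → ℝ) := Measure.pi fun _ => nu

instance (k : ℕ) : IsProbabilityMeasure (mu k) := by unfold mu; infer_instance

lemma mu_eq (k : ℕ) : mu k = volume.restrict (Set.Icc 0 1) := by
  unfold mu nu
  rw [← Measure.restrict_pi_pi, Set.pi_univ_Icc, volume_pi]
  rfl

lemma mm_eq {k : ℕ} (G : LPoly k) : mm G = ∫ t, Real.log ‖E G t‖ ∂mu k := by
  rw [mu_eq]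
  unfold mm
  simp only [evalT_eq]

/-- Splitting off the first variable. -/
lemma mp_cons (k : ℕ) : MeasurePreserving (fun y : (Fin k → ℝ) × ℝ => (Fin.cons y.2 y.1 : Fin (k+1) → ℝ))
    ((mu k).prod nu) (mu (k+1)) := by
  have h := (measurePreserving_piFinSuccAbove (fun _ : Fin (k+1) => nu) 0).symm
  have h2 := h.comp (Measure.measurePreserving_swap (μ := mu k) (ν := nu))
  convert h2 using 1
  · funext y
    exact (Fin.insertNth_zero' y.2 y.1).symm
  · rfl

lemma me_cons (k : ℕ) : MeasurableEmbedding
    (fun y : (Fin k → ℝ) × ℝ => (Fin.cons y.2 y.1 : Fin (k+1) → ℝ)) := by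
  have h := (MeasurableEquiv.piFinSuccAbove (fun _ : Fin (k+1) => ℝ) 0).symm.measurableEmbedding
  have h2 := h.comp (MeasurableEquiv.prodComm (α := (Fin k → ℝ)) (β := ℝ)).measurableEmbedding
  convert h2 using 1
  funext y
  exact (Fin.insertNth_zero' y.2 y.1).symm

lemma cons_inj_right {α : Type*} {k : ℕ} (j : α) {a b : Fin k → α}
    (h : (Fin.cons j a : Fin (k+1) → α) = Fin.cons j b) : a = b := by
  funext i
  have := congrFun h i.succ
  simpa using this

/-- Coefficient of the `j`-th power of the first variable. -/
def co {k : ℕ} (j : ℤ) (G : LPoly (k+1)) : LPoly k :=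
  G.comapDomain (fun e => Fin.cons j e) (fun _ _ _ _ h => cons_inj_right j h)

lemma co_apply {k : ℕ} (j : ℤ) (G : LPoly (k+1)) (e : Fin k → ℤ) :
    co j G e = G (Fin.cons j e) := rfl

lemma E_co {k : ℕ} (j : ℤ) (G : LPoly (k+1)) (x : Fin k → ℝ) :
    E (co j G) x = ∑ e ∈ G.support, 
      if e 0 = j then G e * ee (∑ i : Fin k, (e i.succ : ℝ) * x i) else 0 := by
  rw [← Finset.sum_filter]
  unfold E Finsupp.sum
  refine Finset.sum_bij (fun e _ => Fin.cons j e) ?_ ?_ ?_ ?_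
  · intro e he
    simp only [Finsupp.mem_support_iff, co_apply] at he
    simp [he]
  · intro a _ b _ h
    exact cons_inj_right j h
  · intro b hb
    simp only [Finset.mem_filter, Finsupp.mem_support_iff] at hb
    refine ⟨Fin.tail b, ?_, ?_⟩
    · simp only [Finsupp.mem_support_iff, co_apply, ← hb.2, Fin.cons_self_tail]
      exact hb.1
    · rw [← hb.2, Fin.cons_self_tail]
  · intro e _
    simp [co_apply]

/-- One variable slice as a polynomial. -/
def hp {k : ℕ} (K : ℤ) (G : LPoly (k+1)) (x : Fin k → ℝ) : ℂ[X] :=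
  ∑ e ∈ G.support, monomial (e 0 + K).toNat (G e * ee (∑ i : Fin k, (e i.succ : ℝ) * x i))

lemma norm_hp {k : ℕ} (K : ℤ) (G : LPoly (k+1)) (hK : ∀ e, G e ≠ 0 → 0 ≤ e 0 + K) 
    (x : Fin k → ℝ) (s : ℝ) : 
    ‖E G (Fin.cons s x)‖ = ‖(hp K G x).eval (ee s)‖ := by
  have : (hp K G x).eval (ee s) = E G (Fin.cons s x) * ee (K * s) := by
    unfold hp E Finsupp.sum
    rw [eval_finsetSum, Finset.sum_mul]
    refine Finset.sum_congr rfl fun e he => ?_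
    have h0 := hK e (by simpa using he)
    change _ = G e * ee (∑ i, (e i : ℝ) * (Fin.cons s x : Fin (k+1) → ℝ) i) * ee (K * s)
    rw [eval_monomial, ← ee_nat_mul, Fin.sum_univ_succ]
    simp only [Fin.cons_zero, Fin.cons_succ]
    rw [mul_assoc, ← ee_add, mul_assoc, ← ee_add]
    congr 2
    have : (((e 0 + K).toNat : ℕ) : ℝ) = e 0 + K := by
      have := Int.toNat_of_nonneg h0
      exact_mod_cast this
    rw [this]; ring
  rw [this, norm_mul, norm_ee, mul_one]

lemma hp_leading {k : ℕ} (K N : ℤ) (G : LPoly (k+1)) (hK : ∀ e, G e ≠ 0 → 0 ≤ e 0 + K) 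
    (hNK : 0 ≤ N + K) (hN : ∀ e, G e ≠ 0 → e 0 ≤ N) (x : Fin k → ℝ) (hx : E (co N G) x ≠ 0) :
    (hp K G x).leadingCoeff = E (co N G) x := by
  have hc : (hp K G x).coeff (N + K).toNat = E (co N G) x := by
    rw [E_co]
    unfold hp
    rw [finsetSum_coeff]
    refine Finset.sum_congr rfl fun e he => ?_
    have h0 := hK e (by simpa using he)
    rw [coeff_monomial]
    have : ((e 0 + K).toNat = (N + K).toNat) ↔ e 0 = N := by omega
    simp only [this]
  have hd : (hp K G x).natDegree ≤ (N + K).toNat := by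
    unfold hp
    apply natDegree_sum_le_of_forall_le
    intro e he
    have h0 := hN e (by simpa using he)
    refine (natDegree_monomial_le _).trans ?_
    omega
  have hd2 : (hp K G x).natDegree = (N + K).toNat := 
    natDegree_eq_of_le_of_coeff_ne_zero hd (by rw [hc]; exact hx)
  rw [leadingCoeff, hd2, hc]

lemma exists_K {k : ℕ} (G : LPoly k) (N : ℤ) : ∃ K : ℤ, 0 ≤ N + K ∧ 
    ∀ e, G e ≠ 0 → ∀ i, 0 ≤ e i + K := by
  refine ⟨|N| + ∑ e ∈ G.support, ∑ i, |e i|, ?_, ?_⟩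
  · have : 0 ≤ ∑ e ∈ G.support, ∑ i, |e i| := 
      Finset.sum_nonneg fun _ _ => Finset.sum_nonneg fun _ _ => abs_nonneg _
    have := neg_abs_le N
    linarith
  · intro e he i
    have h1 : ∑ i, |e i| ≤ ∑ e ∈ G.support, ∑ i, |e i| := 
      Finset.single_le_sum (f := fun e : Fin k → ℤ => ∑ i, |e i|) 
        (fun _ _ => Finset.sum_nonneg fun _ _ => abs_nonneg _) (by simpa using he)
    have h2 : |e i| ≤ ∑ i, |e i| := 
      Finset.single_le_sum (f := fun i => |e i|) (fun _ _ => abs_nonneg _) (by simp)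
    have := neg_abs_le (e i)
    have := abs_nonneg N
    linarith

lemma exists_top {k : ℕ} (G : LPoly (k+1)) (hG : G ≠ 0) : 
    ∃ N : ℤ, (∀ e, G e ≠ 0 → e 0 ≤ N) ∧ co N G ≠ 0 := by
  obtain ⟨e, he, hmax⟩ := Finset.exists_max_image G.support (fun e => e 0) 
    (Finsupp.support_nonempty_iff.2 hG)
  refine ⟨e 0, fun f hf => hmax f (by simpa using hf), fun h => ?_⟩
  have := DFunLike.congr_fun h (Fin.tail e)
  rw [co_apply, Fin.cons_self_tail] at this
  simp at he
  exact he this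

lemma slice_pair {k : ℕ} (G : LPoly (k+1)) (N : ℤ) (hN : ∀ e, G e ≠ 0 → e 0 ≤ N)
    (hi : Integrable (fun x => Real.log ‖E (co N G) x‖) (mu k)) 
    (hc : ∀ᵐ x ∂mu k, E (co N G) x ≠ 0) :
    Integrable (fun y : (Fin k → ℝ) × ℝ => Real.log ‖E G (Fin.cons y.2 y.1)‖) ((mu k).prod nu) ∧
    ∀ᵐ y ∂((mu k).prod nu), E G (Fin.cons y.2 y.1) ≠ 0 := by
  obtain ⟨K, hNK, hK⟩ := exists_K G N
  refine step_integrable (mu k) (fun y => E G (Fin.cons y.2 y.1)) 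
    ((continuous_E G).measurable.comp (me_cons k).measurable) (hp K G) 
    (fun x s => norm_hp K G (fun e he => hK e he 0) x s) (Bd G) (one_le_Bd G) 
    (fun y => norm_E_le _ _) (fun x => E (co N G) x) hc
    (fun x hx => hp_leading K N G (fun e he => hK e he 0) hNK hN x hx) hi

lemma E_integrable : ∀ {k : ℕ} (G : LPoly k), G ≠ 0 → 
    Integrable (fun t => Real.log ‖E G t‖) (mu k) ∧ ∀ᵐ t ∂mu k, E G t ≠ 0 := by
  intro k
  induction k with
  | zero =>
    intro G hG
    have h0 : ∀ t, E G t = G 0 := by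
      intro t
      unfold E
      rw [Finsupp.sum_of_support_subset (s := {0}) _ (by intro e _; simp [Subsingleton.elim e 0])]
      · simp [ee_zero]
      · simp
    have h1 : G 0 ≠ 0 := by
      intro h
      apply hG
      refine Finsupp.ext fun e => ?_
      rw [Subsingleton.elim e 0, h]; rfl
    simp only [h0]
    exact ⟨integrable_const _, Eventually.of_forall fun _ => h1⟩
  | succ k ih =>
    intro G hG
    obtain ⟨N, hN, hco⟩ := exists_top G hG
    obtain ⟨a, b⟩ := ih _ hco
    obtain ⟨c, d⟩ := slice_pair G N hN a b
    constructor
    · exact ((mp_cons k).integrable_comp_emb (me_cons k)).1 c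
    · rw [← (mp_cons k).map_eq, (me_cons k).ae_map_iff]
      exact d

lemma slice_lower {k : ℕ} (G : LPoly (k+1)) (N : ℤ) (hN : ∀ e, G e ≠ 0 → e 0 ≤ N)
    (x : Fin k → ℝ) (hx : E (co N G) x ≠ 0) :
    Real.log ‖E (co N G) x‖ ≤ ∫ s, Real.log ‖E G (Fin.cons s x)‖ ∂nu := by
  obtain ⟨K, hNK, hK⟩ := exists_K G N
  have h0 : ∀ e, G e ≠ 0 → 0 ≤ e 0 + K := fun e he => hK e he 0
  simp only [norm_hp K G h0]
  rw [← mahler_eq, logMahlerMeasure_eq_log_MahlerMeasure, ← hp_leading K N G h0 hNK hN x hx]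
  refine Real.log_le_log ?_ (leadingCoeff_le_mahlerMeasure _)
  rw [hp_leading K N G h0 hNK hN x hx]
  exact norm_pos_iff.2 hx

/-- The substitution merging the first variable into the second as its `n`-th power. -/
def Tm (l n : ℕ) : Matrix (Fin (l+1)) (Fin (l+2)) ℤ :=
  Matrix.of fun i => Fin.cons (if i = 0 then (n : ℤ) else 0) (fun j => if i = j then 1 else 0)

lemma substExp_Tm {l n : ℕ} (e : Fin (l+2) → ℤ) (i : Fin (l+1)) :
    substExp (Tm l n) e i = (if i = 0 then (n : ℤ) * e 0 else 0) + e i.succ := by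
  unfold substExp Tm
  rw [Fin.sum_univ_succ]
  simp

lemma E_Tm {l n : ℕ} (G : LPoly (l+2)) (s : ℝ) (x : Fin l → ℝ) :
    E (substM (Tm l n) G) (Fin.cons s x) = 
      E G (Fin.cons (n * s) (Fin.cons s x : Fin (l+1) → ℝ)) := by
  rw [E_substM]
  congr 1
  funext j
  refine Fin.cases ?_ (fun j => ?_) j
  · simp [Tm]
  · simp [Tm]

/-- The slice in the first two variables. -/
def pp {l : ℕ} (K : ℤ) (G : LPoly (l+2)) (x : Fin l → ℝ) : ℂ[X][X] :=
  ∑ e ∈ G.support, monomial (e 1 + K).toNat (monomial (e 0 + K).toNat 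
    (G e * ee (∑ i : Fin l, (e i.succ.succ : ℝ) * x i)))

lemma norm_pp {l : ℕ} (K : ℤ) (G : LPoly (l+2)) (hK : ∀ e, G e ≠ 0 → ∀ i, 0 ≤ e i + K) 
    (x : Fin l → ℝ) (u s : ℝ) : 
    ‖E G (Fin.cons u (Fin.cons s x : Fin (l+1) → ℝ))‖ = ‖(gw (pp K G x) (ee u)).eval (ee s)‖ := by
  have : (gw (pp K G x) (ee u)).eval (ee s) = 
      E G (Fin.cons u (Fin.cons s x : Fin (l+1) → ℝ)) * ee (K * u + K * s) := by
    unfold gw pp E Finsupp.sum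
    rw [Polynomial.map_sum, eval_finsetSum, Finset.sum_mul]
    refine Finset.sum_congr rfl fun e he => ?_
    have h0 := hK e (by simpa using he)
    change _ = G e * ee (∑ i, (e i : ℝ) * 
      (Fin.cons u (Fin.cons s x : Fin (l+1) → ℝ) : Fin (l+2) → ℝ) i) * ee (K * u + K * s)
    rw [map_monomial, eval_monomial, coe_evalRingHom, eval_monomial, ← ee_nat_mul, ← ee_nat_mul, 
      Fin.sum_univ_succ, Fin.sum_univ_succ]
    simp only [Fin.cons_zero, Fin.cons_succ]
    rw [Fin.succ_zero_eq_one, mul_assoc, mul_assoc, ← ee_add, ← ee_add, mul_assoc, ← ee_add]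
    congr 2
    have a : (((e 0 + K).toNat : ℕ) : ℝ) = e 0 + K := by
      have := Int.toNat_of_nonneg (h0 0)
      exact_mod_cast this
    have b : (((e 1 + K).toNat : ℕ) : ℝ) = e 1 + K := by
      have := Int.toNat_of_nonneg (h0 1)
      exact_mod_cast this
    rw [a, b]; ring
  rw [this, norm_mul, norm_ee, mul_one]

lemma norm_Tm {l n : ℕ} (K : ℤ) (G : LPoly (l+2)) (hK : ∀ e, G e ≠ 0 → ∀ i, 0 ≤ e i + K) 
    (x : Fin l → ℝ) (s : ℝ) : 
    ‖E (substM (Tm l n) G) (Fin.cons s x)‖ = ‖(qn (pp K G x) n).eval (ee s)‖ := by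
  rw [E_Tm, norm_pp K G hK, eval_qn, ee_nat_mul]

lemma Tm_apply {l n : ℕ} (G : LPoly (l+2)) (f : Fin (l+1) → ℤ) :
    substM (Tm l n) G f = ∑ e ∈ G.support, if substExp (Tm l n) e = f then G e else 0 := by
  classical
  unfold substM Finsupp.mapDomain Finsupp.sum
  rw [Finsupp.finsetSum_apply]
  refine Finset.sum_congr rfl fun e _ => ?_
  rw [Finsupp.single_apply]

lemma Tm_top {l : ℕ} (G : LPoly (l+2)) (N0 N1 : ℤ) (h0 : ∀ e, G e ≠ 0 → e 0 ≤ N0)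
    (h1 : ∀ e, co N0 G e ≠ 0 → e 0 ≤ N1) : 
    ∀ᶠ n : ℕ in atTop, (∀ f, substM (Tm l n) G f ≠ 0 → f 0 ≤ N1 + n * N0) ∧ 
      co (N1 + n * N0) (substM (Tm l n) G) = co N1 (co N0 G) := by
  obtain ⟨M, hM⟩ := (G.support.image (fun e => e 1)).bddAbove
  have hM : ∀ e, G e ≠ 0 → e 1 ≤ M := fun e he => 
    hM (by simpa using ⟨e, he, rfl⟩)
  have h1' : ∀ e, G e ≠ 0 → e 0 = N0 → e 1 ≤ N1 := by
    intro e he h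
    have := h1 (Fin.tail e) (by rw [co_apply, ← h, Fin.cons_self_tail]; exact he)
    exact this
  filter_upwards [eventually_gt_atTop (M - N1).toNat] with n hn
  have hn : M - N1 < n := by omega
  have key : ∀ e, G e ≠ 0 → e 0 ≠ N0 → n * e 0 + e 1 < N1 + n * N0 := by
    intro e he h
    have a := h0 e he
    have b := hM e he
    have c : e 0 ≤ N0 - 1 := by omega
    have : (n : ℤ) * e 0 ≤ n * (N0 - 1) := mul_le_mul_of_nonneg_left c (by positivity)
    linarith
  constructor
  · intro f hf
    rw [Tm_apply] at hf
    obtain ⟨e, he, hef⟩ := Finset.exists_ne_zero_of_sum_ne_zero hf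
    have he' : G e ≠ 0 := by simpa using he
    have : substExp (Tm l n) e = f := by
      by_contra hne
      rw [if_neg hne] at hef
      exact hef rfl
    rw [← this, substExp_Tm]
    simp only [if_true, Fin.succ_zero_eq_one]
    by_cases h : e 0 = N0
    · have := h1' e he' h
      rw [h]; linarith
    · exact (key e he' h).le
  · refine Finsupp.ext fun f => ?_
    rw [co_apply, co_apply, co_apply, Tm_apply]
    have tgt : substExp (Tm l n) (Fin.cons N0 (Fin.cons N1 f : Fin (l+1) → ℤ)) = 
        Fin.cons (N1 + n * N0) f := by
      funext i
      rw [substExp_Tm]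
      refine Fin.cases ?_ (fun i => ?_) i
      · simp [add_comm]
      · simp
    rw [Finset.sum_eq_single (Fin.cons N0 (Fin.cons N1 f : Fin (l+1) → ℤ))]
    · rw [if_pos tgt]
    · intro e he hne
      have he' : G e ≠ 0 := by simpa using he
      rw [if_neg]
      intro h
      apply hne
      have hz := congrFun h 0
      rw [substExp_Tm] at hz
      simp only [if_true, Fin.succ_zero_eq_one, Fin.cons_zero] at hz
      have e0 : e 0 = N0 := by
        by_contra hh
        have := key e he' hh
        linarith
      have e1 : e 1 = N1 := by
        rw [e0] at hz; linarith
      funext i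
      refine Fin.cases ?_ (fun i => ?_) i
      · simpa using e0
      · refine Fin.cases ?_ (fun i => ?_) i
        · simpa using e1
        · have := congrFun h i.succ
          rw [substExp_Tm] at this
          simpa using this
    · intro h
      rw [if_pos tgt]
      simpa using h

lemma co_zero {k : ℕ} (j : ℤ) : co j (0 : LPoly (k+1)) = 0 := by
  refine Finsupp.ext fun e => ?_
  rw [co_apply]; rfl

lemma mm_slice {k : ℕ} (G : LPoly (k+1)) (hG : G ≠ 0) :
    mm G = ∫ x, ∫ s, Real.log ‖E G (Fin.cons s x)‖ ∂nu ∂mu k := by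
  have hi := ((mp_cons k).integrable_comp_emb (me_cons k)).2 (E_integrable G hG).1
  rw [mm_eq, ← (mp_cons k).integral_comp (me_cons k)]
  exact integral_prod _ hi

lemma mm_slice_two {l : ℕ} (G : LPoly (l+2)) (hG : G ≠ 0) (K : ℤ) 
    (hK : ∀ e, G e ≠ 0 → ∀ i, 0 ≤ e i + K) :
    mm G = ∫ x, ∫ u, (gw (pp K G x) (ee u)).logMahlerMeasure ∂nu ∂mu l := by
  have hi := ((mp_cons (l+1)).integrable_comp_emb (me_cons (l+1))).2 (E_integrable G hG).1
  have hi2 := hi.integral_prod_left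
  rw [mm_slice G hG, ← (mp_cons l).integral_comp (me_cons l)]
  have hi3 := ((mp_cons l).integrable_comp_emb (me_cons l)).2 hi2
  refine (integral_prod _ hi3).trans ?_
  refine integral_congr_ae (Eventually.of_forall fun x => ?_)
  simp only [Function.comp, mahler_eq, norm_pp K G hK]
  have hh := integrable_gw (pp K G x) (le_refl (1:ℝ))
  simp only [Complex.ofReal_one, one_mul] at hh
  exact (integral_integral_swap hh).symm

lemma log_le_Bd {k : ℕ} (G : LPoly k) (t : Fin k → ℝ) : Real.log ‖E G t‖ ≤ Real.log (Bd G) := by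
  rcases (norm_nonneg (E G t)).eq_or_lt with h | h
  · rw [← h, Real.log_zero]
    exact Real.log_nonneg (one_le_Bd G)
  · exact Real.log_le_log h (norm_E_le G t)

lemma tendsto_mm {l : ℕ} (G : LPoly (l+2)) (hG : G ≠ 0) :
    (∀ᶠ n : ℕ in atTop, substM (Tm l n) G ≠ 0) ∧ 
    Tendsto (fun n : ℕ => mm (substM (Tm l n) G)) atTop (𝓝 (mm G)) := by
  obtain ⟨N0, h0, hc0⟩ := exists_top G hG
  obtain ⟨N1, h1, hc1⟩ := exists_top _ hc0
  obtain ⟨K, -, hK⟩ := exists_K G 0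
  have htop := Tm_top G N0 N1 h0 h1
  have hne : ∀ᶠ n : ℕ in atTop, substM (Tm l n) G ≠ 0 := by
    filter_upwards [htop] with n hn h
    rw [h, co_zero] at hn
    exact hc1 hn.2.symm
  refine ⟨hne, ?_⟩
  obtain ⟨ci, cn⟩ := E_integrable _ hc1
  rw [mm_slice_two G hG K hK]
  have hrw : ∀ᶠ n : ℕ in atTop, 
      ∫ x, ∫ s, Real.log ‖E (substM (Tm l n) G) (Fin.cons s x)‖ ∂nu ∂mu l = 
        mm (substM (Tm l n) G) := by
    filter_upwards [hne] with n hn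
    rw [mm_slice _ hn]
  refine Tendsto.congr' hrw ?_
  refine tendsto_integral_filter_of_dominated_convergence 
    (fun x => Real.log (Bd G) + |Real.log ‖E (co N1 (co N0 G)) x‖|) ?_ ?_ ?_ ?_
  · filter_upwards [hne] with n hn
    have hi := ((mp_cons l).integrable_comp_emb (me_cons l)).2 (E_integrable _ hn).1
    exact hi.integral_prod_left.aestronglyMeasurable
  · filter_upwards [htop] with n hn
    filter_upwards [cn] with x hx
    have lo := slice_lower (substM (Tm l n) G) _ hn.1 x (by rw [hn.2]; exact hx)
    rw [hn.2] at lo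
    have up : ∫ s, Real.log ‖E (substM (Tm l n) G) (Fin.cons s x)‖ ∂nu ≤ Real.log (Bd G) := by
      have : ∫ _ : ℝ, Real.log (Bd G) ∂nu = Real.log (Bd G) := by simp
      rw [← this]
      refine integral_mono ?_ (integrable_const _) fun s => ?_
      · simp only [norm_Tm K G hK]
        exact mahler_integrable _
      · simp only [E_Tm]
        exact log_le_Bd G _
    rw [Real.norm_eq_abs, abs_le]
    have := Real.log_nonneg (one_le_Bd G)
    have a1 := neg_abs_le (Real.log ‖E (co N1 (co N0 G)) x‖)
    have a2 := abs_nonneg (Real.log ‖E (co N1 (co N0 G)) x‖)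
    constructor <;> linarith
  · exact (integrable_const _).add ci.abs
  · refine Eventually.of_forall fun x => ?_
    have := main_two (pp K G x)
    refine this.congr fun n => ?_
    simp only [norm_Tm K G hK, mahler_eq]

lemma final_zero {k : ℕ} (F : LPoly k) (A : Matrix (Fin 0) (Fin k) ℤ) (hA : substM A F ≠ 0) :
    mm (substM A F) ∈ M1set F := by
  have hE : ∀ t, E (substM A F) t = E F 0 := by
    intro t
    rw [E_substM]
    congr 1
  have hE1 : ∀ t, E (substM (rowMat (0 : Fin k → ℤ)) F) t = E F 0 := by
    intro t
    rw [E_substM]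
    congr 1
    funext j
    simp [rowMat]
  refine ⟨0, ?_, ?_⟩
  · intro h
    obtain ⟨-, hn⟩ := E_integrable _ hA
    obtain ⟨t, ht⟩ := hn.exists
    rw [hE, ← hE1 0, h] at ht
    exact ht (by simp [E])
  · rw [mm_eq, mm_eq]
    simp [hE, hE1]

lemma final_main {k : ℕ} (F : LPoly k) : ∀ (l : ℕ) (A : Matrix (Fin l) (Fin k) ℤ), 
    substM A F ≠ 0 → mm (substM A F) ∈ closure (M1set F) := by
  intro l
  induction l using Nat.strong_induction_on with
  | _ l ih =>
    match l, ih with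
    | 0, _ => 
      intro A hA
      exact subset_closure (final_zero F A hA)
    | 1, _ => 
      intro A hA
      have : A = rowMat (A 0) := by
        ext i j
        rw [Subsingleton.elim i 0]
        rfl
      rw [this] at hA ⊢
      exact subset_closure ⟨_, hA, rfl⟩
    | l+2, ih =>
      intro A hA
      obtain ⟨h1, h2⟩ := tendsto_mm _ hA
      refine isClosed_closure.mem_of_tendsto h2 ?_
      filter_upwards [h1] with n hn
      rw [substM_substM] at hn ⊢
      exact ih (l+1) (by omega) _ hn

end MahlerAux

/-- Each `m(F_A)` (for nonzero `F_A`) is a limit of values `m(F_r)` with `r ∈ ℤ^k`;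
consequently `ℳ(F)` is contained in the closure of `ℳ₁(F)`. -/
theorem Mset_subset_closure_M1set {k : ℕ} (F : LPoly k) (hF : F ≠ 0) :
    (∀ (l : ℕ) (A : Matrix (Fin l) (Fin k) ℤ), substM A F ≠ 0 →
      mm (substM A F) ∈ closure (M1set F)) ∧
    Mset F ⊆ closure (M1set F) := by
  refine ⟨MahlerAux.final_main F, ?_⟩
  rintro x ⟨l, A, hA, rfl⟩
  exact MahlerAux.final_main F l A hA
end
end

section
/- Let F be a nonzero Laurent polynomial in k variables with complex coefficients. Then the set ℳ(F) = { m(F_A) : A ∈ ℤ^{ℓ×k}, 0 ≤ ℓ, F_A ≠ 0 } is a closed subset of ℝ, and it equals the closure of ℳ₁(F) = { m(F_r) : r ∈ ℤ^k, F_r ≠ 0 }. -/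
open MeasureTheory

noncomputable section

open Filter Topology

/-- the torus -/
abbrev TT (d : ℕ) := Fin d → UnitAddCircle

/-- character -/
abbrev ch {d : ℕ} (n : Fin d → ℤ) (x : TT d) : ℂ := UnitAddTorus.mFourier n x

instance probTT (d : ℕ) : IsProbabilityMeasure (volume : Measure (TT d)) := by
  have : IsProbabilityMeasure (volume : Measure UnitAddCircle) := ⟨UnitAddCircle.measure_univ⟩
  rw [volume_pi]
  infer_instance

lemma ch_add_left {d : ℕ} (m n : Fin d → ℤ) (x : TT d) : ch (m + n) x = ch m x * ch n x :=
  UnitAddTorus.mFourier_add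

lemma ch_add_right {d : ℕ} (n : Fin d → ℤ) (x y : TT d) : ch n (x + y) = ch n x * ch n y := by
  simp only [ch, UnitAddTorus.mFourier, ContinuousMap.coe_mk, ← Finset.prod_mul_distrib]
  refine Finset.prod_congr rfl fun i _ => ?_
  simp [fourier_apply, smul_add, AddCircle.toCircle_add]

lemma ch_norm {d : ℕ} (n : Fin d → ℤ) (x : TT d) : ‖ch n x‖ = 1 := by
  simp only [ch, UnitAddTorus.mFourier, ContinuousMap.coe_mk, fourier_apply, norm_prod]
  exact Finset.prod_eq_one fun i _ => Circle.norm_coe _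

lemma ch_zero {d : ℕ} (x : TT d) : ch 0 x = 1 := by
  simp [ch, UnitAddTorus.mFourier_zero]

lemma ch_neg {d : ℕ} (n : Fin d → ℤ) (x : TT d) : ch (-n) x = (starRingEnd ℂ) (ch n x) :=
  UnitAddTorus.mFourier_neg

lemma ch_cont {d : ℕ} (n : Fin d → ℤ) : Continuous (fun x : TT d => ch n x) :=
  (UnitAddTorus.mFourier n).continuous

lemma ch_coe {d : ℕ} (n : Fin d → ℤ) (t : Fin d → ℝ) :
    ch n (fun i => (t i : UnitAddCircle)) = ∏ i, torusPt t i ^ (n i) := by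
  simp only [ch, UnitAddTorus.mFourier, ContinuousMap.coe_mk, torusPt]
  refine Finset.prod_congr rfl fun i _ => ?_
  rw [fourier_coe_apply, ← Complex.exp_int_mul]
  congr 1
  push_cast
  ring

/-- evaluation on the torus -/
def evX {d : ℕ} (S : Finset (Fin d → ℤ)) (c : (Fin d → ℤ) → ℂ) (x : TT d) : ℂ :=
  ∑ e ∈ S, c e * ch e x

lemma evX_cont {d : ℕ} (S : Finset (Fin d → ℤ)) (c : (Fin d → ℤ) → ℂ) :
    Continuous (evX S c) := by
  unfold evX
  exact continuous_finsetSum _ fun e _ => continuous_const.mul (ch_cont e)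

lemma mm_eq {d : ℕ} (F : LPoly d) :
    mm F = ∫ x : TT d, Real.log ‖evX F.support F x‖ := by
  have hmp : MeasurePreserving (fun (t : Fin d → ℝ) (i : Fin d) => (t i : UnitAddCircle))
      (Measure.pi fun _ : Fin d => (volume : Measure ℝ).restrict (Set.Ioc 0 (0 + 1)))
      (Measure.pi fun _ : Fin d => (volume : Measure UnitAddCircle)) :=
    measurePreserving_pi _ _ (fun i => UnitAddCircle.measurePreserving_mk 0)
  have hc : Measurable (fun x : TT d => Real.log ‖evX F.support F x‖) :=
    Real.measurable_log.comp (evX_cont _ _).norm.measurable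
  rw [volume_pi, ← hmp.map_eq, integral_map hmp.measurable.aemeasurable hc.aestronglyMeasurable,
    ← Measure.restrict_pi_pi, mm, volume_pi]
  have : (fun t : Fin d → ℝ => Real.log ‖evalT F (torusPt t)‖) =
      fun t => Real.log ‖evX F.support F (fun i => (t i : UnitAddCircle))‖ := by
    funext t
    simp only [evalT, evX, ch_coe]
  rw [this]
  have h2 := (Measure.univ_pi_Ioc_ae_eq_Icc (μ := fun _ : Fin d => (volume : Measure ℝ))
    (f := fun _ => 0) (g := fun _ => 1))
  simp only [zero_add]
  exact (setIntegral_congr_set h2).symm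

lemma ch_exists {d : ℕ} {n : Fin d → ℤ} (hn : n ≠ 0) : ∃ h : TT d, ch n h ≠ 1 := by
  obtain ⟨i, hi⟩ := Function.ne_iff.mp hn
  refine ⟨Pi.single i ((1 / 2 / (n i : ℝ) : ℝ) : UnitAddCircle), ?_⟩
  have : ch n (Pi.single i ((1 / 2 / (n i : ℝ) : ℝ) : UnitAddCircle)) = -1 := by
    simp only [ch, UnitAddTorus.mFourier, ContinuousMap.coe_mk]
    rw [Finset.prod_eq_single i]
    · rw [Pi.single_eq_same, fourier_coe_apply]
      have : (2 * Real.pi * Complex.I * (n i : ℂ) * ((1 / 2 / (n i : ℝ) : ℝ) : ℂ) / (1 : ℝ))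
        = Real.pi * Complex.I := by
        have : (n i : ℂ) ≠ 0 := by exact_mod_cast hi
        push_cast
        field_simp
      rw [this, Complex.exp_pi_mul_I]
    · intro j _ hj
      rw [Pi.single_eq_of_ne hj]
      simp
    · simp
  rw [this]
  norm_num

lemma ch_int {d : ℕ} {n : Fin d → ℤ} (hn : n ≠ 0) : ∫ x : TT d, ch n x = 0 := by
  obtain ⟨h, hh⟩ := ch_exists hn
  have h1 : ∫ x : TT d, ch n (x + h) = ∫ x : TT d, ch n x :=
    integral_add_right_eq_self (fun x => ch n x) h
  simp only [ch_add_right, integral_mul_const] at h1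
  have h2 : (∫ x : TT d, ch n x) * (ch n h - 1) = 0 := by rw [mul_sub, h1]; ring
  rcases mul_eq_zero.mp h2 with h3 | h3
  · exact h3
  · exact absurd (sub_eq_zero.mp h3) hh

lemma ch_int_of {d : ℕ} (x : Fin d → ℤ) : Integrable (fun t : TT d => ch x t) :=
  (ch_cont x).integrable_of_hasCompactSupport (HasCompactSupport.of_compactSpace _)

lemma ch_zsmul_sub {d : ℕ} (n : Fin d → ℤ) (i j : ℕ) (x : TT d) :
    ch (((i : ℤ) - (j : ℤ)) • n) x = ch n x ^ i * (starRingEnd ℂ) (ch n x ^ j) := by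
  have key : ∀ k : ℕ, ch ((k : ℤ) • n) x = ch n x ^ k := by
    intro k
    induction k with
    | zero => simpa using ch_zero x
    | succ k ih =>
      rw [pow_succ, ← ih, ← ch_add_left]
      congr 1
      push_cast
      rw [add_smul, one_smul]
  rw [sub_smul, sub_eq_add_neg, ch_add_left, ch_neg, key, key]

lemma int_K {d : ℕ} {n : Fin d → ℤ} (hn : n ≠ 0) (M : ℕ) :
    ∫ x : TT d, ‖∑ j ∈ Finset.range M, ch n x ^ j‖ ^ 2 = M := by
  have h : ∫ x : TT d, ((‖∑ j ∈ Finset.range M, ch n x ^ j‖ ^ 2 : ℝ) : ℂ) = M := by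
    have h1 : ∀ x : TT d, ((‖∑ j ∈ Finset.range M, ch n x ^ j‖ ^ 2 : ℝ) : ℂ) =
        ∑ i ∈ Finset.range M, ∑ j ∈ Finset.range M, ch (((i : ℤ) - (j : ℤ)) • n) x := by
      intro x
      simp only [ch_zsmul_sub]
      rw [← Finset.sum_mul_sum, ← map_sum, Complex.mul_conj, Complex.normSq_eq_norm_sq]
    simp only [h1]
    rw [integral_finsetSum _ fun i _ => integrable_finsetSum _ fun j _ => ch_int_of _]
    have h2 : ∀ i ∈ Finset.range M, ∫ x : TT d, ∑ j ∈ Finset.range M,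
        ch (((i : ℤ) - (j : ℤ)) • n) x = 1 := by
      intro i hi
      rw [integral_finsetSum _ fun j _ => ch_int_of _, Finset.sum_eq_single i]
      · simp [ch_zero]
      · intro j _ hj
        apply ch_int
        apply smul_ne_zero _ hn
        intro h
        apply hj
        omega
      · intro h; exact absurd hi h
    rw [Finset.sum_congr rfl h2]
    simp
  have h0 := integral_complex_ofReal (μ := (volume : Measure (TT d)))
    (f := fun x => ‖∑ j ∈ Finset.range M, ch n x ^ j‖ ^ 2)
  rw [h0] at h
  exact_mod_cast h

lemma ch_small_nat {d : ℕ} {n : Fin d → ℤ} (hn : n ≠ 0) (M : ℕ) (hM : 0 < M) :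
    volume.real {x : TT d | ‖ch n x - 1‖ < 1 / (2 * M)} ≤ 4 / M := by
  have hM' : (0 : ℝ) < M := by exact_mod_cast hM
  have hsub : {x : TT d | ‖ch n x - 1‖ < 1 / (2 * M)} ⊆
      {x : TT d | (M / 2 : ℝ) ^ 2 ≤ ‖∑ j ∈ Finset.range M, ch n x ^ j‖ ^ 2} := by
    intro x hx
    simp only [Set.mem_ofPred_eq] at hx ⊢
    apply pow_le_pow_left₀ (by positivity)
    have h1 : ∀ j ∈ Finset.range M, ‖ch n x ^ j - 1‖ ≤ 1 / 2 := by
      intro j hj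
      rw [← geom_sum_mul, norm_mul]
      have : ‖∑ i ∈ Finset.range j, ch n x ^ i‖ ≤ M := by
        refine (norm_sum_le _ _).trans ?_
        simp only [norm_pow, ch_norm, one_pow, Finset.sum_const, Finset.card_range, nsmul_eq_mul,
          mul_one]
        exact_mod_cast (Finset.mem_range.mp hj).le
      calc _ ≤ (M : ℝ) * (1 / (2 * M)) := by gcongr
        _ = 1 / 2 := by field_simp
    have h2 : ‖∑ j ∈ Finset.range M, (ch n x ^ j - 1)‖ ≤ M * (1 / 2) := by
      refine (norm_sum_le_of_le _ h1).trans ?_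
      simp
    rw [Finset.sum_sub_distrib] at h2
    simp only [Finset.sum_const, Finset.card_range, nsmul_eq_mul, mul_one] at h2
    have h3 := norm_sub_norm_le (M : ℂ) (∑ j ∈ Finset.range M, ch n x ^ j)
    rw [norm_sub_rev, Complex.norm_natCast] at h3
    linarith
  have h4 := mul_meas_ge_le_integral_of_nonneg (μ := (volume : Measure (TT d)))
    (f := fun x => ‖∑ j ∈ Finset.range M, ch n x ^ j‖ ^ 2)
    (Eventually.of_forall fun x => by positivity)
    (((continuous_finsetSum _ fun j _ => (ch_cont n).pow j).norm.pow 2).integrable_of_hasCompactSupport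
      (HasCompactSupport.of_compactSpace _)) ((M / 2 : ℝ) ^ 2)
  rw [int_K hn] at h4
  have h5 := measureReal_mono (μ := (volume : Measure (TT d))) hsub
  refine h5.trans ?_
  rw [le_div_iff₀ hM']
  have : (M : ℝ) ^ 2 / 4 * volume.real {x : TT d | (M / 2 : ℝ) ^ 2 ≤ ‖∑ j ∈ Finset.range M, ch n x ^ j‖ ^ 2} ≤ M := by
    convert h4 using 2
    ring
  have h6 : (M : ℝ) * (volume.real {x : TT d | (M / 2 : ℝ) ^ 2 ≤ ‖∑ j ∈ Finset.range M, ch n x ^ j‖ ^ 2} * M) ≤ M * 4 := by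
    nlinarith
  exact le_of_mul_le_mul_left h6 hM'

lemma ch_small {d : ℕ} {n : Fin d → ℤ} (hn : n ≠ 0) (η : ℝ) (hη : 0 < η) :
    volume.real {x : TT d | ‖ch n x - 1‖ < η} ≤ 16 * η := by
  by_cases h : η ≤ 1 / 2
  · set M := ⌊1 / (2 * η)⌋₊ with hMdef
    have h1 : 1 ≤ 1 / (2 * η) := by rw [le_div_iff₀ (by positivity)]; linarith
    have hM : 0 < M := Nat.floor_pos.mpr h1
    have hM1 : (M : ℝ) ≤ 1 / (2 * η) := Nat.floor_le (by positivity)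
    have hM2 : 1 / (2 * η) < M + 1 := Nat.lt_floor_add_one _
    have hM' : (1 : ℝ) ≤ M := by exact_mod_cast hM
    have hsub : {x : TT d | ‖ch n x - 1‖ < η} ⊆ {x : TT d | ‖ch n x - 1‖ < 1 / (2 * M)} := by
      intro x hx
      simp only [Set.mem_ofPred_eq] at hx ⊢
      refine hx.trans_le ?_
      rw [le_div_iff₀ (by positivity)] at hM1 ⊢
      linarith
    refine (measureReal_mono hsub).trans ((ch_small_nat hn M hM).trans ?_)
    rw [div_lt_iff₀ (by positivity)] at hM2
    rw [div_le_iff₀ (by positivity)]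
    nlinarith
  · refine measureReal_le_one.trans ?_
    linarith

lemma fub {d : ℕ} (E B : Set (TT d)) (hE : MeasurableSet E) (hB : MeasurableSet B) (K : ℝ)
    (hK : 0 ≤ K)
    (h : ∀ h, h ∉ B → volume.real {x | x ∈ E ∧ x + h ∈ E} ≤ K) :
    volume.real E ^ 2 ≤ volume.real B + K := by
  have hmp := measurePreserving_prod_add (volume : Measure (TT d)) (volume : Measure (TT d))
  have h1 := hmp.measure_preimage (hE.prod hE).nullMeasurableSet
  rw [Measure.prod_prod, Measure.prod_apply_symm (hmp.measurable (hE.prod hE))] at h1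
  have h2 : ∫⁻ y : TT d, volume ((fun x : TT d => (x, y)) ⁻¹'
      ((fun z : TT d × TT d => (z.1, z.1 + z.2)) ⁻¹' (E ×ˢ E))) ≤
      ∫⁻ y : TT d, (B.indicator 1 y + ENNReal.ofReal K) := by
    apply lintegral_mono
    intro y
    by_cases hy : y ∈ B
    · simp only [Set.indicator_of_mem hy, Pi.one_apply]
      exact prob_le_one.trans le_self_add
    · simp only [Set.indicator_of_notMem hy, zero_add]
      have := h y hy
      rw [← ofReal_measureReal]
      exact ENNReal.ofReal_le_ofReal this
  rw [h1, lintegral_add_right _ measurable_const, lintegral_indicator_one hB] at h2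
  simp only [lintegral_const, measure_univ, mul_one] at h2
  have h3 := ENNReal.toReal_mono (by finiteness) h2
  rw [ENNReal.toReal_mul, ENNReal.toReal_add (by finiteness) (by finiteness),
    ENNReal.toReal_ofReal hK] at h3
  rw [sq]
  exact h3

lemma sublevel (d : ℕ) (n : ℕ) : ∃ (N : ℕ) (C : ℝ), 1 ≤ N ∧ 1 ≤ C ∧
    ∀ S : Finset (Fin d → ℤ), S.card ≤ n → ∀ (c : (Fin d → ℤ) → ℂ) (e0), e0 ∈ S →
    ∀ ε : ℝ, 0 < ε → ε ≤ 1 →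
    volume.real {x : TT d | ‖evX S c x‖ < ε ^ N * ‖c e0‖} ≤ C * ε := by
  classical
  induction n with
  | zero =>
    refine ⟨1, 1, le_rfl, le_rfl, ?_⟩
    intro S hS c e0 he0
    rw [Nat.le_zero, Finset.card_eq_zero] at hS
    simp [hS] at he0
  | succ n ih =>
    obtain ⟨N, C, _, hC, ih⟩ := ih
    refine ⟨2 * N + 3, 16 + C, by omega, by linarith, ?_⟩
    intro S hS c e0 he0 ε hε hε1
    by_cases hε2 : ε ≤ 1 / 2
    swap
    · refine measureReal_le_one.trans ?_
      nlinarith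
    by_cases hex : ∃ e1 ∈ S, e1 ≠ e0
    swap
    · push Not at hex
      have hS1 : S = {e0} := by
        ext e
        simp only [Finset.mem_singleton]
        exact ⟨hex e, fun h => h ▸ he0⟩
      have : {x : TT d | ‖evX S c x‖ < ε ^ (2 * N + 3) * ‖c e0‖} = ∅ := by
        ext x
        simp only [Set.mem_ofPred_eq, Set.mem_empty_iff_false, iff_false, not_lt, hS1, evX,
          Finset.sum_singleton, norm_mul, ch_norm, mul_one]
        have : ε ^ (2 * N + 3) ≤ 1 := pow_le_one₀ hε.le hε1
        nlinarith [norm_nonneg (c e0)]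
      rw [this]
      simp
      positivity
    obtain ⟨e1, he1, hne⟩ := hex
    set E := {x : TT d | ‖evX S c x‖ < ε ^ (2 * N + 3) * ‖c e0‖} with hEdef
    set B := {h : TT d | ‖ch (e0 - e1) h - 1‖ < ε ^ 2} with hBdef
    have hEm : MeasurableSet E :=
      (isOpen_lt (evX_cont S c).norm continuous_const).measurableSet
    have hBm : MeasurableSet B :=
      (isOpen_lt ((ch_cont _).sub continuous_const).norm continuous_const).measurableSet
    have hB : volume.real B ≤ 16 * ε ^ 2 :=
      ch_small (sub_ne_zero.mpr hne.symm) _ (by positivity)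
    have hmain := fub E B hEm hBm (C * ε ^ 2) (by positivity) ?_
    · have : volume.real E ^ 2 ≤ ((16 + C) * ε) ^ 2 := by nlinarith [sq_nonneg ε]
      exact le_of_sq_le_sq this (by positivity)
    intro h hh
    simp only [hBdef, Set.mem_ofPred_eq, not_lt] at hh
    set c' : (Fin d → ℤ) → ℂ := fun e => c e * (ch e h - ch e1 h) with hc'
    have hq : ∀ x, evX (S.erase e1) c' x = evX S c (x + h) - ch e1 h * evX S c x := by
      intro x
      have h1 : evX (S.erase e1) c' x = evX S c' x := by
        unfold evX
        refine Finset.sum_subset (Finset.erase_subset _ _) ?_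
        intro e he hne
        have : e = e1 := by
          by_contra h0
          exact hne (Finset.mem_erase.mpr ⟨h0, he⟩)
        simp [hc', this]
      rw [h1]
      simp only [evX, Finset.mul_sum, ← Finset.sum_sub_distrib, hc', ch_add_right]
      refine Finset.sum_congr rfl fun e _ => ?_
      ring
    have hc0 : ε ^ 2 * ‖c e0‖ ≤ ‖c' e0‖ := by
      have : ch e0 h - ch e1 h = (ch (e0 - e1) h - 1) * ch e1 h := by
        rw [sub_mul, ← ch_add_left, sub_add_cancel, one_mul]
      simp only [hc']
      rw [this, norm_mul, norm_mul, ch_norm, mul_one, mul_comm]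
      gcongr
    have hfin := ih (S.erase e1) (by rw [Finset.card_erase_of_mem he1]; omega) c' e0
      (Finset.mem_erase.mpr ⟨hne.symm, he0⟩) (ε ^ 2) (by positivity) (by nlinarith)
    refine (measureReal_mono ?_).trans hfin
    rintro x ⟨hx1, hx2⟩
    simp only [hEdef, Set.mem_ofPred_eq] at hx1 hx2 ⊢
    rw [hq]
    calc _ ≤ ‖evX S c (x + h)‖ + ‖ch e1 h * evX S c x‖ := norm_sub_le _ _
      _ = ‖evX S c (x + h)‖ + ‖evX S c x‖ := by rw [norm_mul, ch_norm, one_mul]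
      _ < ε ^ (2 * N + 3) * ‖c e0‖ + ε ^ (2 * N + 3) * ‖c e0‖ := add_lt_add hx2 hx1
      _ = (2 * ε) * ((ε ^ 2) ^ N * (ε ^ 2 * ‖c e0‖)) := by ring
      _ ≤ 1 * ((ε ^ 2) ^ N * (ε ^ 2 * ‖c e0‖)) := by gcongr; linarith
      _ ≤ (ε ^ 2) ^ N * ‖c' e0‖ := by rw [one_mul]; gcongr

/-- cutoffs -/
def dl (a : ℝ) (N : ℕ) (j : ℕ) : ℝ := ((1 / 2 : ℝ) ^ j) ^ N * a

lemma dl_pos {a : ℝ} (ha : 0 < a) (N j : ℕ) : 0 < dl a N j := by unfold dl; positivity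

lemma log_dl {a : ℝ} (ha : 0 < a) (N j : ℕ) :
    Real.log (dl a N j) = Real.log a - j * (N * Real.log 2) := by
  unfold dl
  rw [Real.log_mul (by positivity) ha.ne', Real.log_pow, Real.log_pow, one_div, Real.log_inv]
  ring

lemma dl_tendsto {a : ℝ} {N : ℕ} (hN : 1 ≤ N) (J : ℕ) :
    Tendsto (fun m => dl a N (J + m)) atTop (𝓝 0) := by
  have h1 : Tendsto (fun m : ℕ => (1 / 2 : ℝ) ^ (J + m)) atTop (𝓝 0) :=
    (tendsto_pow_atTop_nhds_zero_of_lt_one (by norm_num) (by norm_num)).comp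
      (tendsto_atTop_mono (fun m => Nat.le_add_left m J) tendsto_id)
  have h2 := (h1.pow N).mul_const a
  simpa [dl, zero_pow (by omega : N ≠ 0)] using h2

lemma pointwise_tail {a : ℝ} (ha : 0 < a) {N : ℕ} (hN : 1 ≤ N) (J : ℕ) (y : ℝ) (hy : 0 ≤ y) :
    ‖Real.log (max y (dl a N J)) - Real.log y‖ₑ ≤
      ∑' i : ℕ, ENNReal.ofReal (N * Real.log 2) * (if y < dl a N (J + i) then 1 else 0) := by
  have hk : 0 < N * Real.log 2 := by
    have : (0 : ℝ) < N := by exact_mod_cast hN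
    have := Real.log_pos one_lt_two
    positivity
  rcases hy.eq_or_lt with h0 | hpos
  · subst h0
    have : ∀ i, ENNReal.ofReal (N * Real.log 2) * (if (0 : ℝ) < dl a N (J + i) then 1 else 0) =
        ENNReal.ofReal (N * Real.log 2) := by
      intro i
      rw [if_pos (dl_pos ha _ _), mul_one]
    simp only [this]
    rw [ENNReal.tsum_const_eq_top_of_ne_zero]
    · exact le_top
    · exact (ENNReal.ofReal_pos.mpr hk).ne'
  · by_cases hyd : dl a N J ≤ y
    · rw [max_eq_left hyd]
      simp
    push Not at hyd
    rw [max_eq_right hyd.le]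
    have hex : ∃ m, dl a N (J + m) ≤ y := by
      have := (dl_tendsto (a := a) hN J).eventually (gt_mem_nhds hpos)
      obtain ⟨m, hm⟩ := this.exists
      exact ⟨m, hm.le⟩
    classical
    set m := Nat.find hex with hm
    have h1 : dl a N (J + m) ≤ y := Nat.find_spec hex
    have h2 : ∀ i < m, y < dl a N (J + i) := fun i hi => not_le.mp (Nat.find_min hex hi)
    refine le_trans ?_ (ENNReal.sum_le_tsum (Finset.range m))
    rw [Finset.sum_congr rfl (g := fun _ => ENNReal.ofReal (N * Real.log 2)) (fun i hi => by
      rw [if_pos (h2 i (Finset.mem_range.mp hi)), mul_one])]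
    rw [Finset.sum_const, Finset.card_range, nsmul_eq_mul, ← ENNReal.ofReal_natCast,
      ← ENNReal.ofReal_mul (by positivity), Real.enorm_eq_ofReal_abs]
    apply ENNReal.ofReal_le_ofReal
    have h3 := Real.log_le_log (dl_pos ha N (J + m)) h1
    have h4 := Real.log_le_log hpos hyd.le
    rw [abs_of_nonneg (by linarith)]
    rw [log_dl ha] at h3 ⊢
    push_cast at h3
    linarith

lemma tail_lint {X : Type*} [MeasurableSpace X] (μ : Measure X) [IsProbabilityMeasure μ]
    (p : X → ℝ) (hp : Measurable p) (hp0 : ∀ x, 0 ≤ p x) {a : ℝ} (ha : 0 < a) {N : ℕ} (hN : 1 ≤ N)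
    {C : ℝ} (hC : 1 ≤ C)
    (h : ∀ ε : ℝ, 0 < ε → ε ≤ 1 → μ.real {x | p x < ε ^ N * a} ≤ C * ε) (J : ℕ) :
    ∫⁻ x, ‖Real.log (max (p x) (dl a N J)) - Real.log (p x)‖ₑ ∂μ ≤
      ENNReal.ofReal (N * Real.log 2 * C * 2 * (1 / 2) ^ J) := by
  have hl := Real.log_pos one_lt_two
  have hm : ∀ i, MeasurableSet {x | p x < dl a N (J + i)} := fun i =>
    measurableSet_lt hp measurable_const
  calc _ ≤ ∫⁻ x, ∑' i : ℕ, ENNReal.ofReal (N * Real.log 2) *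
        (if p x < dl a N (J + i) then 1 else 0) ∂μ :=
        lintegral_mono fun x => pointwise_tail ha hN J (p x) (hp0 x)
    _ = ∑' i : ℕ, ∫⁻ x, ENNReal.ofReal (N * Real.log 2) *
        (if p x < dl a N (J + i) then 1 else 0) ∂μ := by
        apply lintegral_tsum
        intro i
        exact (measurable_const.mul
          (Measurable.ite (hm i) measurable_const measurable_const)).aemeasurable
    _ = ∑' i : ℕ, ENNReal.ofReal (N * Real.log 2) * μ {x | p x < dl a N (J + i)} := by
        refine tsum_congr fun i => ?_
        rw [lintegral_const_mul _ (Measurable.ite (hm i) measurable_const measurable_const)]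
        congr 1
        rw [← lintegral_indicator_one (hm i)]
        rfl
    _ ≤ ∑' i : ℕ, ENNReal.ofReal (N * Real.log 2 * C * (1 / 2) ^ J * (1 / 2) ^ i) := by
        refine ENNReal.tsum_le_tsum fun i => ?_
        rw [← ofReal_measureReal (s := {x | p x < dl a N (J + i)}),
          ← ENNReal.ofReal_mul (by positivity)]
        apply ENNReal.ofReal_le_ofReal
        have := h ((1 / 2) ^ (J + i)) (by positivity) (pow_le_one₀ (by norm_num) (by norm_num))
        calc _ ≤ N * Real.log 2 * (C * (1 / 2) ^ (J + i)) := by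
              gcongr
              exact this
          _ = _ := by rw [pow_add]; ring
    _ = _ := by
        rw [← ENNReal.ofReal_tsum_of_nonneg (fun i => by positivity)
          ((summable_geometric_of_lt_one (by norm_num) (by norm_num)).mul_left _),
          tsum_mul_left, tsum_geometric_of_lt_one (by norm_num) (by norm_num)]
        congr 1
        norm_num
        ring

lemma tail_int {X : Type*} [MeasurableSpace X] (μ : Measure X) [IsProbabilityMeasure μ]
    (p : X → ℝ) (hp : Measurable p) (hp0 : ∀ x, 0 ≤ p x) {a : ℝ} (ha : 0 < a) {N : ℕ} (hN : 1 ≤ N)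
    {C : ℝ} (hC : 1 ≤ C)
    (h : ∀ ε : ℝ, 0 < ε → ε ≤ 1 → μ.real {x | p x < ε ^ N * a} ≤ C * ε) (J : ℕ)
    (hi : Integrable (fun x => Real.log (max (p x) (dl a N J))) μ) :
    |(∫ x, Real.log (max (p x) (dl a N J)) ∂μ) - ∫ x, Real.log (p x) ∂μ| ≤
      N * Real.log 2 * C * 2 * (1 / 2) ^ J := by
  have hl := Real.log_pos one_lt_two
  have h1 := tail_lint μ p hp hp0 ha hN hC h J
  have hm : Measurable fun x => Real.log (max (p x) (dl a N J)) - Real.log (p x) :=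
    (Real.measurable_log.comp (hp.max measurable_const)).sub (Real.measurable_log.comp hp)
  have h2 : Integrable (fun x => Real.log (max (p x) (dl a N J)) - Real.log (p x)) μ :=
    ⟨hm.aestronglyMeasurable, h1.trans_lt ENNReal.ofReal_lt_top⟩
  have h3 : Integrable (fun x => Real.log (p x)) μ := by
    convert hi.sub h2 using 1
    funext x
    simp
  rw [← integral_sub hi h3]
  have h4 := (enorm_integral_le_lintegral_enorm
    (fun x => Real.log (max (p x) (dl a N J)) - Real.log (p x)) (μ := μ)).trans h1
  rw [Real.enorm_eq_ofReal_abs] at h4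
  exact (ENNReal.ofReal_le_ofReal_iff (by positivity)).mp h4

/-- the one-parameter subgroup attached to `s` -/
def phi {l : ℕ} (s : Fin l → ℤ) (x : TT 1) : TT l := fun i => s i • x 0

lemma phi_cont {l : ℕ} (s : Fin l → ℤ) : Continuous (phi s) := by
  unfold phi
  fun_prop

lemma substExp_row {l : ℕ} (s e : Fin l → ℤ) : substExp (rowMat s) e = fun _ => ∑ j, s j * e j := by
  funext i
  simp [substExp, rowMat]

lemma ch_phi {l : ℕ} (s e : Fin l → ℤ) (x : TT 1) :
    ch e (phi s x) = ch (substExp (rowMat s) e) x := by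
  rw [substExp_row]
  simp only [ch, UnitAddTorus.mFourier, ContinuousMap.coe_mk, phi, Finset.univ_unique,
    Finset.prod_singleton, Fin.default_eq_zero]
  generalize x 0 = y
  have : ∀ T : Finset (Fin l), ∏ i ∈ T, fourier (e i) (s i • y) = fourier (∑ i ∈ T, s i * e i) y := by
    intro T
    classical
    induction T using Finset.induction_on with
    | empty => simp
    | insert i T hi ih =>
      rw [Finset.prod_insert hi, Finset.sum_insert hi, ih, fourier_add]
      congr 1
      simp only [fourier_apply, smul_smul, mul_comm]
  exact this _

lemma evX_subst {l : ℕ} (s : Fin l → ℤ) (G : LPoly l) (x : TT 1) :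
    evX (substM (rowMat s) G).support (substM (rowMat s) G) x = evX G.support G (phi s x) := by
  have h := Finsupp.sum_mapDomain_index (f := substExp (rowMat s)) (s := G)
    (h := fun e c => c * ch e x) (by simp) (by intros; ring)
  simp only [evX, ch_phi]
  exact h

lemma weyl {l : ℕ} {ι : Type*} (L : Filter ι) (s : ι → Fin l → ℤ)
    (hs : ∀ w : Fin l → ℤ, w ≠ 0 → ∀ᶠ i in L, ∑ j, s i j * w j ≠ 0) (f : C(TT l, ℂ)) :
    Tendsto (fun i => ∫ x : TT 1, f (phi (s i) x)) L (𝓝 (∫ x : TT l, f x)) := by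
  have integ : ∀ (g : C(TT l, ℂ)) (r : Fin l → ℤ), Integrable fun x : TT 1 => g (phi r x) :=
    fun g r => (g.continuous.comp (phi_cont r)).integrable_of_hasCompactSupport
      (HasCompactSupport.of_compactSpace _)
  have integ' : ∀ (g : C(TT l, ℂ)), Integrable fun x : TT l => g x :=
    fun g => g.continuous.integrable_of_hasCompactSupport
      (HasCompactSupport.of_compactSpace _)
  have hspan : ∀ g ∈ Submodule.span ℂ (Set.range (UnitAddTorus.mFourier (d := Fin l))),
      Tendsto (fun i => ∫ x : TT 1, g (phi (s i) x)) L (𝓝 (∫ x : TT l, g x)) := by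
    intro g hg
    induction hg using Submodule.span_induction with
    | mem g hg =>
      obtain ⟨n, rfl⟩ := hg
      by_cases hn : n = 0
      · subst hn
        simpa [UnitAddTorus.mFourier_zero] using tendsto_const_nhds
      · have h1 : ∫ x : TT l, UnitAddTorus.mFourier n x = 0 := ch_int hn
        rw [h1]
        refine tendsto_const_nhds.congr' ?_
        filter_upwards [hs n hn] with i hi
        have h2 : (fun x : TT 1 => UnitAddTorus.mFourier n (phi (s i) x)) =
          fun x => ch (substExp (rowMat (s i)) n) x := by
          funext x
          exact ch_phi _ _ _
        rw [h2, ch_int]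
        rw [substExp_row]
        intro h
        exact hi (congrFun h 0)
    | zero => simpa using tendsto_const_nhds
    | add g h _ _ hg hh =>
      simp only [ContinuousMap.add_apply]
      rw [integral_add (integ' g) (integ' h)]
      refine (hg.add hh).congr fun i => ?_
      rw [integral_add (integ g _) (integ h _)]
    | smul a g _ hg =>
      simp only [ContinuousMap.smul_apply]
      rw [integral_smul]
      refine (hg.const_smul a).congr fun i => ?_
      rw [integral_smul]
  rw [Metric.tendsto_nhds]
  intro ε hε
  have hmem : f ∈ (Submodule.span ℂ (Set.range (UnitAddTorus.mFourier (d := Fin l)))).topologicalClosure := by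
    rw [UnitAddTorus.span_mFourier_closure_eq_top]
    trivial
  obtain ⟨g, hg, hfg⟩ := Metric.mem_closure_iff.mp hmem (ε / 3) (by positivity)
  have hle : ∀ y, ‖f y - g y‖ ≤ ε / 3 := by
    intro y
    have := (f - g).norm_coe_le_norm y
    rw [dist_eq_norm] at hfg
    exact this.trans hfg.le
  filter_upwards [Metric.tendsto_nhds.mp (hspan g hg) (ε / 3) (by positivity)] with i hi
  have h1 : dist (∫ x : TT 1, f (phi (s i) x)) (∫ x : TT 1, g (phi (s i) x)) ≤ ε / 3 := by
    rw [dist_eq_norm, ← integral_sub (integ f _) (integ g _)]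
    refine (norm_integral_le_of_norm_le_const (C := ε / 3)
      (Eventually.of_forall fun x => hle _)).trans ?_
    simp
  have h2 : dist (∫ x : TT l, g x) (∫ x : TT l, f x) ≤ ε / 3 := by
    rw [dist_comm, dist_eq_norm, ← integral_sub (integ' f) (integ' g)]
    refine (norm_integral_le_of_norm_le_const (C := ε / 3)
      (Eventually.of_forall fun x => hle _)).trans ?_
    simp
  have := dist_triangle4 (∫ x : TT 1, f (phi (s i) x)) (∫ x : TT 1, g (phi (s i) x))
    (∫ x : TT l, g x) (∫ x : TT l, f x)
  linarith

lemma weyl_real {l : ℕ} {ι : Type*} (L : Filter ι) (s : ι → Fin l → ℤ)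
    (hs : ∀ w : Fin l → ℤ, w ≠ 0 → ∀ᶠ i in L, ∑ j, s i j * w j ≠ 0) (f : TT l → ℝ)
    (hf : Continuous f) :
    Tendsto (fun i => ∫ x : TT 1, f (phi (s i) x)) L (𝓝 (∫ x : TT l, f x)) := by
  have h := weyl L s hs ⟨fun x => (f x : ℂ), Complex.continuous_ofReal.comp hf⟩
  simp only [ContinuousMap.coe_mk, integral_complex_ofReal] at h
  exact (Complex.continuous_re.tendsto _).comp h

lemma inj_ev {l : ℕ} {ι : Type*} (L : Filter ι) (s : ι → Fin l → ℤ)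
    (hs : ∀ w : Fin l → ℤ, w ≠ 0 → ∀ᶠ i in L, ∑ j, s i j * w j ≠ 0) (S : Finset (Fin l → ℤ)) :
    ∀ᶠ i in L, Set.InjOn (substExp (rowMat (s i))) S := by
  have h : ∀ᶠ i in L, ∀ e ∈ S, ∀ e' ∈ S, e - e' ≠ 0 → ∑ j, s i j * (e - e') j ≠ 0 := by
    rw [Finset.eventually_all]
    intro e _
    rw [Finset.eventually_all]
    intro e' _
    by_cases h : e - e' = 0
    · simp [h]
    · filter_upwards [hs _ h] with i hi _ using hi
  filter_upwards [h] with i hi e he e' he' heq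
  by_contra hne
  refine hi e he e' he' (sub_ne_zero.mpr hne) ?_
  rw [substExp_row, substExp_row] at heq
  have := congrFun heq 0
  simp only [Pi.sub_apply, mul_sub, Finset.sum_sub_distrib]
  exact sub_eq_zero.mpr this

theorem lawton {l : ℕ} {ι : Type*} (L : Filter ι) (s : ι → Fin l → ℤ)
    (hs : ∀ w : Fin l → ℤ, w ≠ 0 → ∀ᶠ i in L, ∑ j, s i j * w j ≠ 0) (G : LPoly l) (hG : G ≠ 0) :
    Tendsto (fun i => mm (substM (rowMat (s i)) G)) L (𝓝 (mm G)) := by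
  classical
  obtain ⟨e0, he0⟩ := Finsupp.support_nonempty_iff.mpr hG
  have ha : 0 < ‖G e0‖ := norm_pos_iff.mpr (Finsupp.mem_support_iff.mp he0)
  obtain ⟨N1, C1, hN1, hC1, hsub1⟩ := sublevel 1 G.support.card
  obtain ⟨N2, C2, hN2, hC2, hsub2⟩ := sublevel l G.support.card
  have hl := Real.log_pos one_lt_two
  rw [Metric.tendsto_nhds]
  intro ε hε
  -- replace both exponents by a common pair
  obtain ⟨N, C, hN, hC, hs1, hs2⟩ : ∃ (N : ℕ) (C : ℝ), 1 ≤ N ∧ 1 ≤ C ∧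
    (∀ S : Finset (Fin 1 → ℤ), S.card ≤ G.support.card → ∀ (c : (Fin 1 → ℤ) → ℂ) (e0), e0 ∈ S →
    ∀ ε : ℝ, 0 < ε → ε ≤ 1 →
    volume.real {x : TT 1 | ‖evX S c x‖ < ε ^ N * ‖c e0‖} ≤ C * ε) ∧
    (∀ ε : ℝ, 0 < ε → ε ≤ 1 →
    volume.real {x : TT l | ‖evX G.support G x‖ < ε ^ N * ‖G e0‖} ≤ C * ε) := by
    refine ⟨max N1 N2, max C1 C2, hN1.trans (le_max_left _ _), hC1.trans (le_max_left _ _), ?_, ?_⟩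
    · intro S hS c e0 he0 ε hε hε1
      refine (measureReal_mono ?_).trans ((hsub1 S hS c e0 he0 ε hε hε1).trans ?_)
      · intro x hx
        simp only [Set.mem_ofPred_eq] at hx ⊢
        refine lt_of_lt_of_le hx ?_
        exact mul_le_mul_of_nonneg_right (pow_le_pow_of_le_one hε.le hε1 (le_max_left _ _))
          (norm_nonneg _)
      · exact mul_le_mul_of_nonneg_right (le_max_left _ _) hε.le
    · intro ε hε hε1
      refine (measureReal_mono ?_).trans ((hsub2 _ le_rfl G e0 he0 ε hε hε1).trans ?_)
      · intro x hx
        simp only [Set.mem_ofPred_eq] at hx ⊢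
        refine lt_of_lt_of_le hx ?_
        exact mul_le_mul_of_nonneg_right (pow_le_pow_of_le_one hε.le hε1 (le_max_right _ _))
          (norm_nonneg _)
      · exact mul_le_mul_of_nonneg_right (le_max_right _ _) hε.le
  obtain ⟨J, hJ⟩ : ∃ J : ℕ, N * Real.log 2 * C * 2 * (1 / 2) ^ J < ε / 3 := by
    have : Tendsto (fun J : ℕ => N * Real.log 2 * C * 2 * (1 / 2 : ℝ) ^ J) atTop (𝓝 0) := by
      simpa using (tendsto_pow_atTop_nhds_zero_of_lt_one (r := (1 / 2 : ℝ)) (by norm_num)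
        (by norm_num)).const_mul (N * Real.log 2 * C * 2)
    exact (this.eventually (gt_mem_nhds (by positivity))).exists
  set δ := dl ‖G e0‖ N J with hδ
  have hδ0 : 0 < δ := dl_pos ha N J
  have hcont : Continuous fun x : TT l => Real.log (max ‖evX G.support G x‖ δ) := by
    refine Continuous.log ((evX_cont _ _).norm.max continuous_const) ?_
    intro x
    exact (lt_of_lt_of_le hδ0 (le_max_right _ _)).ne'
  have hlim := weyl_real L s hs _ hcont
  have hG2 := tail_int volume (fun x => ‖evX G.support G x‖) (evX_cont _ _).norm.measurable
    (fun x => norm_nonneg _) ha hN hC hs2 J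
    (hcont.integrable_of_hasCompactSupport (HasCompactSupport.of_compactSpace _))
  filter_upwards [Metric.tendsto_nhds.mp hlim (ε / 3) (by positivity),
    inj_ev L s hs G.support] with i hi hinj
  have hval : substM (rowMat (s i)) G (substExp (rowMat (s i)) e0) = G e0 :=
    Finsupp.mapDomain_apply' (G.support : Set (Fin l → ℤ)) G subset_rfl hinj he0
  have hcard : (substM (rowMat (s i)) G).support.card ≤ G.support.card :=
    (Finset.card_le_card Finsupp.mapDomain_support).trans Finset.card_image_le
  have hsl := hs1 _ hcard (substM (rowMat (s i)) G) (substExp (rowMat (s i)) e0) (by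
    rw [Finsupp.mem_support_iff, hval]
    exact Finsupp.mem_support_iff.mp he0)
  rw [hval] at hsl
  simp only [evX_subst] at hsl
  have hH2 := tail_int volume (fun x => ‖evX G.support G (phi (s i) x)‖)
    ((evX_cont _ _).comp (phi_cont _)).norm.measurable
    (fun x => norm_nonneg _) ha hN hC hsl J
    ((hcont.comp (phi_cont _)).integrable_of_hasCompactSupport (HasCompactSupport.of_compactSpace _))
  rw [mm_eq, mm_eq]
  simp only [evX_subst]
  rw [Real.dist_eq] at hi ⊢
  rw [abs_lt] at *
  rw [abs_le] at *
  constructor <;> linarith [hi.1, hi.2, hG2.1, hG2.2, hH2.1, hH2.2]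

lemma subst_comp {l k : ℕ} (A : Matrix (Fin l) (Fin k) ℤ) (s : Fin l → ℤ) (r : Fin k → ℤ)
    (h : ∀ e : Fin k → ℤ, ∑ j, r j * e j = ∑ i, s i * substExp A e i) (F : LPoly k) :
    substM (rowMat s) (substM A F) = substM (rowMat r) F := by
  unfold substM
  rw [← Finsupp.mapDomain_comp]
  congr 1
  funext e
  simp only [Function.comp, substExp_row]
  funext _
  exact (h e).symm

lemma pow_generic (l : ℕ) (w : Fin l → ℤ) (hw : w ≠ 0) :
    ∀ᶠ n : ℕ in atTop, ∑ j : Fin l, (n : ℤ) ^ (j : ℕ) * w j ≠ 0 := by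
  set P : Polynomial ℤ := ∑ j : Fin l, Polynomial.monomial (j : ℕ) (w j) with hP
  have hP0 : P ≠ 0 := by
    obtain ⟨i, hi⟩ := Function.ne_iff.mp hw
    intro h
    apply hi
    have : P.coeff i = w i := by
      simp only [hP, Polynomial.finsetSum_coeff, Polynomial.coeff_monomial]
      rw [Finset.sum_eq_single i]
      · simp
      · intro j _ hj
        rw [if_neg]
        exact fun h => hj (Fin.ext h)
      · simp
    rw [← this, h]
    simp
  have hfin : {n : ℕ | P.eval (n : ℤ) = 0}.Finite := by
    have h1 : {z : ℤ | P.eval z = 0}.Finite := by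
      refine (P.roots.toFinset.finite_toSet).subset ?_
      intro z hz
      simpa [hP0] using hz
    exact h1.preimage (f := fun n : ℕ => (n : ℤ)) (Nat.cast_injective.injOn)
  have h2 := hfin.eventually_cofinite_notMem
  rw [Nat.cofinite_eq_atTop] at h2
  filter_upwards [h2] with n hn h
  apply hn
  simp only [Set.mem_ofPred_eq, hP, Polynomial.eval_finsetSum, Polynomial.eval_monomial]
  rw [← h]
  exact Finset.sum_congr rfl fun _ _ => mul_comm _ _

lemma Mset_sub {k : ℕ} (F : LPoly k) : Mset F ⊆ closure (M1set F) := by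
  rintro x ⟨l, A, hA, rfl⟩
  set s : ℕ → Fin l → ℤ := fun n j => (n : ℤ) ^ (j : ℕ) with hs
  have hlim := lawton atTop s (pow_generic l) _ hA
  refine mem_closure_of_tendsto hlim ?_
  filter_upwards [inj_ev atTop s (pow_generic l) (substM A F).support] with n hn
  obtain ⟨e0, he0⟩ := Finsupp.support_nonempty_iff.mpr hA
  have hval : substM (rowMat (s n)) (substM A F) (substExp (rowMat (s n)) e0) = substM A F e0 :=
    Finsupp.mapDomain_apply' ((substM A F).support : Set (Fin l → ℤ)) _ subset_rfl hn he0
  have hne : substM (rowMat (s n)) (substM A F) ≠ 0 := by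
    intro h
    rw [h] at hval
    exact Finsupp.mem_support_iff.mp he0 hval.symm
  have hc := subst_comp A (s n) (fun j => ∑ i, s n i * A i j) (by
    intro e
    simp only [substExp, Finset.mul_sum, Finset.sum_mul]
    rw [Finset.sum_comm]
    refine Finset.sum_congr rfl fun i _ => Finset.sum_congr rfl fun j _ => ?_
    ring) F
  rw [hc] at hne ⊢
  exact ⟨_, hne, rfl⟩

/-- the pairing with `r` as a linear map -/
def pair {k : ℕ} (r : Fin k → ℤ) : (Fin k → ℤ) →ₗ[ℤ] ℤ := Fintype.linearCombination ℤ r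

lemma pair_apply {k : ℕ} (r v : Fin k → ℤ) : pair r v = ∑ j, r j * v j := by
  simp [pair, Fintype.linearCombination_apply, mul_comm]

/-- vectors which are eventually orthogonal -/
def Lam {k : ℕ} (U : Filter (Fin k → ℤ)) : Submodule ℤ (Fin k → ℤ) where
  carrier := {v | ∀ᶠ r in U, pair r v = 0}
  add_mem' := by
    intro a b ha hb
    filter_upwards [ha, hb] with r h1 h2
    rw [map_add, h1, h2, add_zero]
  zero_mem' := Eventually.of_forall fun r => map_zero _
  smul_mem' := by
    intro c a ha
    filter_upwards [ha] with r h1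
    rw [map_smul, h1, smul_zero]

lemma mem_Lam {k : ℕ} (U : Filter (Fin k → ℤ)) (v : Fin k → ℤ) :
    v ∈ Lam U ↔ ∀ᶠ r in U, pair r v = 0 := Iff.rfl

lemma Lam_split {k : ℕ} (U : Filter (Fin k → ℤ)) [U.NeBot] :
    ∃ (l : ℕ) (p : (Fin k → ℤ) →ₗ[ℤ] (Fin l → ℤ)) (σ : (Fin l → ℤ) →ₗ[ℤ] (Fin k → ℤ)),
      (∀ w, p (σ w) = w) ∧ ∀ v, p v = 0 ↔ v ∈ Lam U := by
  have htf : Module.IsTorsionFree ℤ ((Fin k → ℤ) ⧸ Lam U) := by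
    rw [Module.isTorsionFree_iff_smul_eq_zero]
    intro c y hy
    obtain ⟨v, rfl⟩ := Submodule.Quotient.mk_surjective _ y
    rw [← Submodule.Quotient.mk_smul, Submodule.Quotient.mk_eq_zero, mem_Lam] at hy
    by_cases hc : c = 0
    · exact Or.inl hc
    · right
      rw [Submodule.Quotient.mk_eq_zero, mem_Lam]
      filter_upwards [hy] with r hr
      rw [map_smul, smul_eq_mul] at hr
      exact (mul_eq_zero.mp hr).resolve_left hc
  obtain ⟨l, b⟩ := Module.basisOfFiniteTypeTorsionFree' (R := ℤ) (M := (Fin k → ℤ) ⧸ Lam U)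
  set p : (Fin k → ℤ) →ₗ[ℤ] (Fin l → ℤ) := b.equivFun.toLinearMap ∘ₗ (Lam U).mkQ with hp
  have hsurj : Function.Surjective p :=
    b.equivFun.surjective.comp (Submodule.mkQ_surjective _)
  obtain ⟨σ, hσ⟩ := Module.projective_lifting_property p LinearMap.id hsurj
  refine ⟨l, p, σ, fun w => LinearMap.congr_fun hσ w, fun v => ?_⟩
  simp [hp]

lemma closure_sub {k : ℕ} (F : LPoly k) : closure (M1set F) ⊆ Mset F := by
  intro x hx
  set f : (Fin k → ℤ) → ℝ := fun r => mm (substM (rowMat r) F) with hf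
  set R : Set (Fin k → ℤ) := {r | substM (rowMat r) F ≠ 0} with hR
  have him : M1set F = f '' R := by
    ext y
    rfl
  rw [him] at hx
  have hne : (comap f (𝓝 x) ⊓ 𝓟 R).NeBot := by
    rw [mem_closure_iff_nhds] at hx
    rw [inf_principal_neBot_iff]
    intro V hV
    obtain ⟨W, hW, hWV⟩ := mem_comap.mp hV
    obtain ⟨y, hyW, r, hr, rfl⟩ := hx W hW
    exact ⟨r, hWV hyW, hr⟩
  set U : Ultrafilter (Fin k → ℤ) := Ultrafilter.of (comap f (𝓝 x) ⊓ 𝓟 R) with hU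
  have hUle : (U : Filter (Fin k → ℤ)) ≤ comap f (𝓝 x) ⊓ 𝓟 R := Ultrafilter.of_le _
  have hlim : Tendsto f U (𝓝 x) := tendsto_iff_comap.mpr (hUle.trans inf_le_left)
  have hUR : ∀ᶠ r in (U : Filter (Fin k → ℤ)), substM (rowMat r) F ≠ 0 :=
    (hUle.trans inf_le_right) (mem_principal_self R)
  obtain ⟨l, p, σ, hσ, hp⟩ := Lam_split (U : Filter (Fin k → ℤ))
  set A : Matrix (Fin l) (Fin k) ℤ := LinearMap.toMatrix' p with hA
  have hAp : ∀ e, substExp A e = p e := by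
    intro e
    have : Matrix.mulVec A e = p e := by
      rw [hA, ← Matrix.toLin'_apply, Matrix.toLin'_toMatrix']
    rw [← this]
    rfl
  set s : (Fin k → ℤ) → Fin l → ℤ := fun r i => pair r (σ (Pi.single i 1)) with hs
  have hsp : ∀ r w, ∑ i, s r i * w i = pair r (σ w) := by
    intro r w
    conv_rhs => rw [pi_eq_sum_univ' w]
    rw [map_sum, map_sum]
    refine Finset.sum_congr rfl fun i _ => ?_
    rw [map_smul, map_smul, smul_eq_mul, mul_comm]
  have hgen : ∀ w : Fin l → ℤ, w ≠ 0 → ∀ᶠ r in (U : Filter (Fin k → ℤ)), ∑ j, s r j * w j ≠ 0 := by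
    intro w hw
    have h1 : σ w ∉ Lam (U : Filter (Fin k → ℤ)) := by
      rw [← hp, hσ]
      exact hw
    rw [mem_Lam] at h1
    have h2 := Ultrafilter.eventually_not.mpr h1
    filter_upwards [h2] with r hr
    rw [hsp]
    exact hr
  have hkill : ∀ᶠ r in (U : Filter (Fin k → ℤ)), ∀ v ∈ Lam (U : Filter (Fin k → ℤ)),
      pair r v = 0 := by
    obtain ⟨T, hT⟩ := IsNoetherian.noetherian (Lam (U : Filter (Fin k → ℤ)))
    have h1 : ∀ᶠ r in (U : Filter (Fin k → ℤ)), ∀ v ∈ T, pair r v = 0 := by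
      rw [Finset.eventually_all]
      intro v hv
      rw [← mem_Lam, ← hT]
      exact Submodule.subset_span hv
    filter_upwards [h1] with r hr v hv
    rw [← hT] at hv
    have : Submodule.span ℤ (T : Set (Fin k → ℤ)) ≤ LinearMap.ker (pair r) :=
      Submodule.span_le.mpr fun v hv => hr v hv
    exact this hv
  have hcomp : ∀ᶠ r in (U : Filter (Fin k → ℤ)),
      substM (rowMat (s r)) (substM A F) = substM (rowMat r) F := by
    filter_upwards [hkill] with r hr
    apply subst_comp
    intro e
    rw [hsp, hAp, ← pair_apply]
    have h1 : e - σ (p e) ∈ Lam (U : Filter (Fin k → ℤ)) := by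
      rw [← hp, map_sub, hσ, sub_self]
    have h2 := hr _ h1
    rw [map_sub] at h2
    exact sub_eq_zero.mp h2
  have hFA : substM A F ≠ 0 := by
    obtain ⟨r, h1, h2⟩ := (hUR.and hcomp).exists
    intro h
    rw [h] at h2
    apply h1
    rw [← h2]
    simp [substM]
  have hlaw := lawton (U : Filter (Fin k → ℤ)) s hgen _ hFA
  have hlim2 : Tendsto f U (𝓝 (mm (substM A F))) := by
    refine hlaw.congr' ?_
    filter_upwards [hcomp] with r hr
    rw [hr]
  exact ⟨l, A, hFA, tendsto_nhds_unique hlim2 hlim⟩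

/-- **Theorem 1.** For a nonzero Laurent polynomial `F` in `k` variables, the set
`ℳ(F)` of Mahler measures of all the nonzero `F_A` is a closed subset of `ℝ`, and
it equals the closure of `ℳ₁(F)`. -/
theorem Mset_isClosed_and_eq_closure {k : ℕ} (F : LPoly k) (hF : F ≠ 0) :
    IsClosed (Mset F) ∧ Mset F = closure (M1set F) := by
  have h : Mset F = closure (M1set F) := (Mset_sub F).antisymm (closure_sub F)
  exact ⟨h ▸ isClosed_closure, h⟩
end
end
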